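/- arXiv:1905.12879 — 3 statements merged into one kernel-verified Lean document; each statement's English description precedes it below -/
import Mathlib

section
/- Let d, m ≥ 1, D > 0, R > 0, U > 0, κ > 0, and δ ∈ (0,1). Let (Ω, F, P) be a probability space with a filtration (F_t)_{t ≥ 0}. For each i ∈ {1,…,m} let θ_i ∈ ℝ^d with ‖θ_i‖ ≤ D. For each t ≥ 1, let x_t ∈ ℝ^d be F_{t-1}-measurable with ‖x_t‖ ≤ 1; let θ̂_{t,i} ∈ ℝ^d be F_{t-1}-measurable with ‖θ̂_{t,i}‖ ≤ D; and let η_{t,i} be an F_t-measurable real random variable with E[η_{t,i} | F_{t-1}] = 0 and |η_{t,i}| ≤ R + U almost surely. Define a_{s,i} = η_{s,i} · x_sᵀ(θ̂_{s,i} - θ_i) and b_{s,i} = (x_sᵀ(θ_i - θ̂_{s,i}))². Then with probability at least 1 - δ, for every i ∈ {1,…,m} and every t ≥ 1: Σ_{s=1}^t a_{s,i} ≤ (κ/4)·Σ_{s=1}^t b_{s,i} + κ/4 + (8(R+U)²/κ)·log((m/δ)·√(1 + 4D²t)). -/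
open Matrix MeasureTheory

/-- Ville's inequality for nonnegative martingales, over an infinite horizon. -/
theorem MeasureTheory.Martingale.measure_exists_ge_le {Ω : Type*} {m0 : MeasurableSpace Ω}
    {μ : Measure Ω} [IsFiniteMeasure μ] {F : Filtration ℕ m0} {f : ℕ → Ω → ℝ}
    (hf : Martingale f F μ) (hnonneg : 0 ≤ f) {a : ℝ} (ha : 0 < a) :
    μ {ω | ∃ n, a ≤ f n ω} ≤ ENNReal.ofReal ((∫ ω, f 0 ω ∂μ) / a) := by
  have hmono : Monotone fun n : ℕ => {ω | ∃ k ≤ n, a ≤ f k ω} := by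
    rintro n n' hn ω ⟨k, hk, h⟩
    exact ⟨k, hk.trans hn, h⟩
  have hset : {ω | ∃ n, a ≤ f n ω} = ⋃ n : ℕ, {ω | ∃ k ≤ n, a ≤ f k ω} := by
    ext ω
    simp only [Set.mem_ofPred_eq, Set.mem_iUnion]
    exact ⟨fun ⟨n, h⟩ => ⟨n, n, le_rfl, h⟩, fun ⟨_, k, _, h⟩ => ⟨k, h⟩⟩
  rw [hset, hmono.measure_iUnion]
  refine iSup_le fun n => ?_
  have hmax := maximal_ineq hf.submartingale hnonneg (ε := ⟨a, ha.le⟩) n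
  have hsub : {ω | ∃ k ≤ n, a ≤ f k ω} ⊆ {ω | ((⟨a, ha.le⟩ : NNReal) : ℝ) ≤
      (Finset.range (n + 1)).sup' Finset.nonempty_range_add_one fun k => f k ω} := by
    rintro ω ⟨k, hk, h⟩
    exact h.trans (Finset.le_sup' (fun k => f k ω) (Finset.mem_range.2 (by omega)))
  have hint : ∫ ω, f n ω ∂μ = ∫ ω, f 0 ω ∂μ := by
    have := hf.setIntegral_eq (Nat.zero_le n) MeasurableSet.univ
    simpa using this.symm
  have hbound := hmax.trans (ENNReal.ofReal_le_ofReal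
    (setIntegral_le_integral (hf.integrable n) (Filter.Eventually.of_forall (hnonneg n))))
  rw [hint] at hbound
  rw [ENNReal.ofReal_div_of_pos ha,
    ENNReal.le_div_iff_mul_le (Or.inl (ENNReal.ofReal_pos.2 ha).ne') (Or.inl ENNReal.ofReal_ne_top),
    mul_comm]
  rw [ENNReal.ofReal_eq_coe_nnreal ha.le]
  exact (mul_le_mul_right (measure_mono hsub) _).trans hbound

/-- Pointwise form of Hoeffding's lemma: the convexity bound for `exp` on `[-c, c]`. -/
theorem Real.exp_mul_sub_le_one_add_mul_tanh {e c : ℝ} (hc : 0 < c) (he : |e| ≤ c) (y : ℝ) :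
    Real.exp (y * e - y ^ 2 * c ^ 2 / 2) ≤ 1 + e / c * Real.tanh (y * c) := by
  obtain ⟨h1, h2⟩ := abs_le.1 he
  have hconv : Real.exp (y * e) ≤ Real.cosh (y * c) + e / c * Real.sinh (y * c) := by
    have h := convexOn_exp.2 (Set.mem_univ (y * c)) (Set.mem_univ (-(y * c)))
      (show 0 ≤ (c + e) / (2 * c) from div_nonneg (by linarith) (by linarith))
      (show 0 ≤ (c - e) / (2 * c) from div_nonneg (by linarith) (by linarith))
      (by field_simp; ring)
    simp only [smul_eq_mul] at h
    have harg : (c + e) / (2 * c) * (y * c) + (c - e) / (2 * c) * -(y * c) = y * e := by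
      field_simp; ring
    rw [harg] at h
    refine h.trans_eq ?_
    rw [Real.cosh_eq, Real.sinh_eq]
    field_simp; ring
  have hcosh := Real.cosh_le_exp_half_sq (y * c)
  have hpos := Real.cosh_pos (y * c)
  rw [Real.tanh_eq_sinh_div_cosh, Real.exp_sub]
  calc Real.exp (y * e) / Real.exp (y ^ 2 * c ^ 2 / 2)
      ≤ Real.exp (y * e) / Real.cosh (y * c) := by
        refine div_le_div_of_nonneg_left (Real.exp_pos _).le hpos ?_
        rwa [← mul_pow]
    _ ≤ (Real.cosh (y * c) + e / c * Real.sinh (y * c)) / Real.cosh (y * c) := by gcongr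
    _ = _ := by field_simp

/-- Products of `1 + ξ k * v k` form a martingale when `ξ` is a bounded martingale difference
sequence and `v` is bounded and predictable. -/
theorem martingale_prod_one_add_mul {Ω : Type*} {m0 : MeasurableSpace Ω} {μ : Measure Ω}
    [IsFiniteMeasure μ] {F : Filtration ℕ m0} {ξ v : ℕ → Ω → ℝ}
    (hξ : ∀ n, Measurable[F (n + 1)] (ξ n)) (hv : ∀ n, Measurable[F n] (v n))
    (hξ_le : ∀ n ω, |ξ n ω| ≤ 1) (hv_le : ∀ n ω, |v n ω| ≤ 1)
    (hξ_cond : ∀ n, μ[ξ n|F n] =ᵐ[μ] 0) :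
    Martingale (fun n ω => ∏ k ∈ Finset.range n, (1 + ξ k ω * v k ω)) F μ := by
  have hmeas : ∀ n, Measurable[F n] fun ω => ∏ k ∈ Finset.range n, (1 + ξ k ω * v k ω) := by
    intro n
    refine Finset.measurable_fun_prod _ fun k hk => ?_
    have hkn : k + 1 ≤ n := Finset.mem_range.1 hk
    exact measurable_const.add (((hξ k).mono (F.mono hkn) le_rfl).mul
      ((hv k).mono (F.mono (by omega)) le_rfl))
  have hbound : ∀ n ω, |∏ k ∈ Finset.range n, (1 + ξ k ω * v k ω)| ≤ 2 ^ n := by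
    intro n ω
    rw [Finset.abs_prod]
    refine (Finset.prod_le_prod (g := fun _ => 2) (fun _ _ => abs_nonneg _)
      fun k _ => ?_).trans_eq (by simp)
    have h : |ξ k ω * v k ω| ≤ 1 := by
      rw [abs_mul]; exact mul_le_one₀ (hξ_le k ω) (abs_nonneg _) (hv_le k ω)
    calc |1 + ξ k ω * v k ω| ≤ |1| + |ξ k ω * v k ω| := abs_add_le _ _
      _ ≤ 2 := by rw [abs_one]; linarith
  have hint : ∀ n, Integrable (fun ω => ∏ k ∈ Finset.range n, (1 + ξ k ω * v k ω)) μ := fun n =>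
    Integrable.of_bound ((hmeas n).mono (F.le n) le_rfl).aestronglyMeasurable (2 ^ n)
      (Filter.Eventually.of_forall (hbound n))
  have hξ_int : ∀ n, Integrable (ξ n) μ := fun n =>
    Integrable.of_bound ((hξ n).mono (F.le _) le_rfl).aestronglyMeasurable 1
      (Filter.Eventually.of_forall (hξ_le n))
  refine martingale_of_condExp_sub_eq_zero_nat (fun n => (hmeas n).stronglyMeasurable) hint
    fun n => ?_
  have hdiff : ((fun ω => ∏ k ∈ Finset.range (n + 1), (1 + ξ k ω * v k ω)) -
      fun ω => ∏ k ∈ Finset.range n, (1 + ξ k ω * v k ω)) =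
      (fun ω => (∏ k ∈ Finset.range n, (1 + ξ k ω * v k ω)) * v n ω) * ξ n := by
    ext ω
    simp only [Pi.sub_apply, Pi.mul_apply, Finset.prod_range_succ]
    ring
  rw [hdiff]
  refine (condExp_stronglyMeasurable_mul_of_bound (F.le n)
    ((hmeas n).mul (hv n)).stronglyMeasurable (hξ_int n) (2 ^ n)
    (Filter.Eventually.of_forall fun ω => ?_)).trans ?_
  · rw [Pi.mul_apply, norm_mul, Real.norm_eq_abs, Real.norm_eq_abs]
    exact (mul_le_of_le_one_right (abs_nonneg _) (hv_le n ω)).trans (hbound n ω)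
  · filter_upwards [hξ_cond n] with ω hω
    simp [hω]

/-- Time-uniform bound for the transform of a bounded martingale difference sequence by a
predictable sequence, at a fixed tilting parameter `r`. -/
theorem measure_exists_lt_sum_mul_le {Ω : Type*} {m0 : MeasurableSpace Ω} {μ : Measure Ω}
    [IsProbabilityMeasure μ] {F : Filtration ℕ m0} {η z : ℕ → Ω → ℝ} {c r ε : ℝ}
    (hc : 0 < c) (hr : 0 < r) (hε : 0 < ε)
    (hη : ∀ n, Measurable[F (n + 1)] (η n)) (hz : ∀ n, Measurable[F n] (z n))
    (hη_cond : ∀ n, μ[η n|F n] =ᵐ[μ] 0) (hη_le : ∀ n, ∀ᵐ ω ∂μ, |η n ω| ≤ c) :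
    μ {ω | ∃ n, r * c ^ 2 / 2 * ∑ k ∈ Finset.range n, z k ω ^ 2 + Real.log (1 / ε) / r <
      ∑ k ∈ Finset.range n, η k ω * z k ω} ≤ ENNReal.ofReal ε := by
  let ξ : ℕ → Ω → ℝ := fun n ω => max (-1) (min 1 (η n ω / c))
  let v : ℕ → Ω → ℝ := fun n ω => Real.tanh (r * z n ω * c)
  have hξ_le : ∀ n ω, |ξ n ω| ≤ 1 := fun n ω =>
    abs_le.2 ⟨le_max_left _ _, max_le (by norm_num) (min_le_left _ _)⟩
  have hv_le : ∀ n ω, |v n ω| ≤ 1 := fun n ω => (Real.abs_tanh_lt_one _).le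
  have hξ_eq : ∀ n ω, |η n ω| ≤ c → ξ n ω = η n ω / c := by
    intro n ω h
    obtain ⟨h1, h2⟩ := abs_le.1 h
    have h3 : η n ω / c ≤ 1 := (div_le_one hc).2 h2
    have h4 : -1 ≤ η n ω / c := by rw [le_div_iff₀ hc]; linarith
    simp only [ξ, min_eq_right h3, max_eq_right h4]
  have hξ_cond : ∀ n, μ[ξ n|F n] =ᵐ[μ] 0 := by
    intro n
    have h1 : ξ n =ᵐ[μ] c⁻¹ • η n := by
      filter_upwards [hη_le n] with ω hω
      rw [hξ_eq n ω hω, Pi.smul_apply, smul_eq_mul, div_eq_inv_mul]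
    refine (condExp_congr_ae h1).trans ((condExp_smul c⁻¹ (η n) (F n)).trans ?_)
    filter_upwards [hη_cond n] with ω hω
    simp [hω]
  have hξ_meas : ∀ n, Measurable[F (n + 1)] (ξ n) := fun n =>
    measurable_const.max (measurable_const.min ((hη n).div_const c))
  have htanh : Measurable Real.tanh := by
    rw [show Real.tanh = fun y => Real.sinh y / Real.cosh y from
      funext Real.tanh_eq_sinh_div_cosh]
    exact Real.measurable_sinh.div Real.measurable_cosh
  have hv_meas : ∀ n, Measurable[F n] (v n) := fun n =>
    htanh.comp (((hz n).const_mul r).mul_const c)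
  have hmart := martingale_prod_one_add_mul hξ_meas hv_meas hξ_le hv_le hξ_cond
  have hnonneg : (0 : ℕ → Ω → ℝ) ≤ fun n ω => ∏ k ∈ Finset.range n, (1 + ξ k ω * v k ω) := by
    intro n ω
    refine Finset.prod_nonneg fun k _ => ?_
    have h : |ξ k ω * v k ω| ≤ 1 := by
      rw [abs_mul]; exact mul_le_one₀ (hξ_le k ω) (abs_nonneg _) (hv_le k ω)
    linarith [(abs_le.1 h).1]
  have hville := hmart.measure_exists_ge_le hnonneg (one_div_pos.2 hε)
  simp only [Finset.range_zero, Finset.prod_empty, integral_const, probReal_univ, one_smul,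
    one_div_one_div] at hville
  refine le_trans (measure_mono_ae ?_) hville
  filter_upwards [ae_all_iff.2 hη_le] with ω hω
  rintro ⟨n, hn⟩
  refine ⟨n, ?_⟩
  have hexp : Real.exp (∑ k ∈ Finset.range n,
      (r * z k ω * η k ω - (r * z k ω) ^ 2 * c ^ 2 / 2)) ≤
      ∏ k ∈ Finset.range n, (1 + ξ k ω * v k ω) := by
    rw [Real.exp_sum]
    refine Finset.prod_le_prod (fun _ _ => (Real.exp_pos _).le) fun k _ => ?_
    rw [hξ_eq k ω (hω k)]
    exact Real.exp_mul_sub_le_one_add_mul_tanh hc (hω k) _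
  refine le_trans ?_ hexp
  rw [← Real.log_le_iff_le_exp (one_div_pos.2 hε)]
  have hsum : ∑ k ∈ Finset.range n, (r * z k ω * η k ω - (r * z k ω) ^ 2 * c ^ 2 / 2) =
      r * (∑ k ∈ Finset.range n, η k ω * z k ω -
        r * c ^ 2 / 2 * ∑ k ∈ Finset.range n, z k ω ^ 2) := by
    rw [Finset.mul_sum, ← Finset.sum_sub_distrib, Finset.mul_sum]
    exact Finset.sum_congr rfl fun k _ => by ring
  rw [hsum, ← div_le_iff₀' hr]
  linarith


/-- Lemma 4 of the paper.
Self-normalized concentration bound for the martingale difference terms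
`a_{s,i} = η_{s,i}·x_sᵀ(θ̂_{s,i} - θ_i)` arising in the confidence-set analysis. -/
theorem martingale_self_normalized_bound
    (d m : ℕ) (hd : 1 ≤ d) (hm : 1 ≤ m)
    (D R U κ δ : ℝ) (hD : 0 < D) (hR : 0 < R) (hU : 0 < U) (hκ : 0 < κ)
    (hδ : δ ∈ Set.Ioo (0 : ℝ) 1)
    {Ω : Type*} {m0 : MeasurableSpace Ω} (P : Measure Ω) [IsProbabilityMeasure P]
    (F : Filtration ℕ m0)
    (θ : Fin m → Fin d → ℝ) (hθ : ∀ i, Real.sqrt (∑ j, θ i j ^ 2) ≤ D)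
    (x : ℕ → Ω → Fin d → ℝ)
    (hx_meas : ∀ t, 1 ≤ t → Measurable[F (t - 1)] (x t))
    (hx_norm : ∀ t, 1 ≤ t → ∀ ω, Real.sqrt (∑ j, x t ω j ^ 2) ≤ 1)
    (θhat : ℕ → Fin m → Ω → Fin d → ℝ)
    (hθhat_meas : ∀ t i, 1 ≤ t → Measurable[F (t - 1)] (θhat t i))
    (hθhat_norm : ∀ t i, 1 ≤ t → ∀ ω, Real.sqrt (∑ j, θhat t i ω j ^ 2) ≤ D)
    (η : ℕ → Fin m → Ω → ℝ)
    (hη_meas : ∀ t i, 1 ≤ t → Measurable[F t] (η t i))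
    (hη_cond : ∀ t i, 1 ≤ t → P[η t i|F (t - 1)] =ᵐ[P] 0)
    (hη_bdd : ∀ t i, 1 ≤ t → ∀ᵐ ω ∂P, |η t i ω| ≤ R + U) :
    ENNReal.ofReal (1 - δ) ≤
      P {ω | ∀ i : Fin m, ∀ t : ℕ, 1 ≤ t →
        ∑ s ∈ Finset.Icc 1 t, η s i ω * (x s ω ⬝ᵥ (θhat s i ω - θ i)) ≤
          κ / 4 * ∑ s ∈ Finset.Icc 1 t, (x s ω ⬝ᵥ (θ i - θhat s i ω)) ^ 2 + κ / 4 +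
            8 * (R + U) ^ 2 / κ * Real.log (m / δ * Real.sqrt (1 + 4 * D ^ 2 * t))} := by
  obtain ⟨hδ0, hδ1⟩ := hδ
  have hc : 0 < R + U := by linarith
  have hm' : (1 : ℝ) ≤ m := by exact_mod_cast hm
  have hε : 0 < δ / m := by positivity
  have hr : 0 < κ / (2 * (R + U) ^ 2) := by positivity
  have hz : ∀ i n, Measurable[F n] fun ω => x (n + 1) ω ⬝ᵥ (θhat (n + 1) i ω - θ i) := by
    intro i n
    have hx := hx_meas (n + 1) (by omega)
    have hh := hθhat_meas (n + 1) i (by omega)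
    rw [Nat.add_sub_cancel] at hx hh
    simp only [dotProduct, Pi.sub_apply]
    exact Finset.measurable_fun_sum _ fun j _ => ((measurable_pi_apply j).comp hx).mul
      (((measurable_pi_apply j).comp hh).sub_const _)
  have hbad := fun i => measure_exists_lt_sum_mul_le (μ := P) (F := F)
    (η := fun n => η (n + 1) i) hc hr hε (fun n => hη_meas (n + 1) i (by omega)) (hz i)
    (fun n => hη_cond (n + 1) i (by omega)) (fun n => hη_bdd (n + 1) i (by omega))
  set B : Fin m → Set Ω := fun i => {ω | ∃ n, κ / (2 * (R + U) ^ 2) * (R + U) ^ 2 / 2 *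
    ∑ k ∈ Finset.range n, (x (k + 1) ω ⬝ᵥ (θhat (k + 1) i ω - θ i)) ^ 2 +
      Real.log (1 / (δ / m)) / (κ / (2 * (R + U) ^ 2)) <
    ∑ k ∈ Finset.range n, η (k + 1) i ω * (x (k + 1) ω ⬝ᵥ (θhat (k + 1) i ω - θ i))}
  have hunion : P (⋃ i, B i) ≤ ENNReal.ofReal δ := by
    refine (measure_iUnion_le B).trans ?_
    rw [tsum_fintype]
    refine (Finset.sum_le_sum fun i _ => hbad i).trans_eq ?_
    rw [Finset.sum_const, Finset.card_univ, Fintype.card_fin, ← ENNReal.ofReal_nsmul, nsmul_eq_mul,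
      mul_div_cancel₀ _ (by positivity)]
  have hcompl : ENNReal.ofReal (1 - δ) ≤ P (⋃ i, B i)ᶜ := by
    have h1 : (1 : ENNReal) ≤ P (⋃ i, B i) + P (⋃ i, B i)ᶜ := by
      rw [← measure_univ (μ := P), ← Set.union_compl_self (⋃ i, B i)]
      exact measure_union_le _ _
    rw [ENNReal.ofReal_sub _ hδ0.le, ENNReal.ofReal_one]
    exact tsub_le_iff_left.2 (h1.trans (by gcongr))
  refine hcompl.trans (measure_mono fun ω hω i t _ => ?_)
  have hgood : ω ∉ B i := fun h => hω (Set.mem_iUnion.2 ⟨i, h⟩)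
  have ht := not_lt.1 fun h => hgood ⟨t, h⟩
  have hshift : ∀ f : ℕ → ℝ, ∑ s ∈ Finset.Icc 1 t, f s = ∑ k ∈ Finset.range t, f (k + 1) := by
    intro f
    rw [Finset.range_eq_Ico, Finset.sum_Ico_add' f 0 t 1]
    rfl
  rw [hshift, hshift]
  refine ht.trans ?_
  have hneg : ∀ k, (x (k + 1) ω ⬝ᵥ (θ i - θhat (k + 1) i ω)) ^ 2 =
      (x (k + 1) ω ⬝ᵥ (θhat (k + 1) i ω - θ i)) ^ 2 := fun k => by
    rw [← neg_sub (θhat (k + 1) i ω) (θ i), dotProduct_neg, neg_sq]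
  have hcoef : κ / (2 * (R + U) ^ 2) * (R + U) ^ 2 / 2 = κ / 4 := by
    field_simp; norm_num
  simp only [hneg, hcoef]
  have hmδ : 1 ≤ m / δ := by rw [le_div_iff₀ hδ0]; linarith
  have hsqrt : 1 ≤ Real.sqrt (1 + 4 * D ^ 2 * t) :=
    Real.one_le_sqrt.2 (by have : 0 ≤ 4 * D ^ 2 * (t : ℝ) := by positivity
                           linarith)
  have hlog : Real.log (m / δ) ≤ Real.log (m / δ * Real.sqrt (1 + 4 * D ^ 2 * t)) :=
    Real.log_le_log (by linarith) (le_mul_of_one_le_right (by linarith) hsqrt)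
  have hlog0 := Real.log_nonneg hmδ
  have hlast : Real.log (1 / (δ / m)) / (κ / (2 * (R + U) ^ 2)) ≤
      8 * (R + U) ^ 2 / κ * Real.log (m / δ * Real.sqrt (1 + 4 * D ^ 2 * t)) := by
    rw [one_div_div]
    calc Real.log (m / δ) / (κ / (2 * (R + U) ^ 2))
        = 2 * (R + U) ^ 2 / κ * Real.log (m / δ) := by field_simp
      _ ≤ 8 * (R + U) ^ 2 / κ * Real.log (m / δ * Real.sqrt (1 + 4 * D ^ 2 * t)) := by
        gcongr
        norm_num
  linarith
end

section
/- Fix d, m ≥ 1, D > 0, R > 0, U > 0, κ > 0, L > 0, λ ≥ max(1, κ/2), and δ ∈ (0,1). Let (F_t)_{t ≥ 0} be a filtration on a probability space. For each i ∈ {1,…,m}, let g_i : ℝ → ℝ be convex with derivative μ_i = g_i' satisfying μ_i'(z) ≥ κ on (-D, D) and |μ_i(z)| ≤ U on [-D, D], and let θ_i ∈ ℝ^d with ‖θ_i‖ ≤ D. For t ≥ 1, let x_t be F_{t-1}-measurable with ‖x_t‖ ≤ 1 and let y_t^i be F_t-measurable with |y_t^i| ≤ R almost surely and E[y_t^i |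 F_{t-1}] = μ_i(θ_iᵀx_t). Define Z_1 = λ·I_d, Z_{t+1} = Z_t + (κ/2)·x_t x_tᵀ, θ̂_{1,i} = 0, and θ̂_{t+1,i} = argmin over ‖θ‖ ≤ D of (1/2)‖θ - θ̂_{t,i}‖_{Z_{t+1}}² + θᵀ∇ℓ_{t,i}(θ̂_{t,i}), where ∇ℓ_{t,i}(θ) = (μ_i(θᵀx_t) - y_t^i)·x_t. Define γ_{t+1} = (16(R+U)²/κ)·log((m/δ)·√(1 + 4D²t)) + λD² + (2(R+U)²/κ)·log(det(Z_{t+1})/det(Z_1)) + κ/2. Then with probability at least 1 - δ, for every i ∈ {1,…,m} and every t ≥ 0: ‖θ_i - θ̂_{t+1,i}‖_{Z_{t+1}}² ≤ γ_{t+1}. -/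
open Matrix MeasureTheory

/-- Pathwise form of Hoeffding's lemma: the exponential is below its chord on `[-c, c]`. -/
lemma exp_mul_sub_sq_le {c u : ℝ} (hc : 0 < c) (hu : |u| ≤ c) (s : ℝ) :
    Real.exp (u * s - c ^ 2 / 2 * s ^ 2) ≤
      1 + u * (Real.sinh (c * s) / c * Real.exp (-(c ^ 2 / 2 * s ^ 2))) := by
  obtain ⟨h1, h2⟩ := abs_le.1 hu
  have ha : 0 ≤ (c + u) / (2 * c) := div_nonneg (by linarith) (by linarith)
  have hb : 0 ≤ (c - u) / (2 * c) := div_nonneg (by linarith) (by linarith)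
  have hab : (c + u) / (2 * c) + (c - u) / (2 * c) = 1 := by field_simp; ring
  have hconv := convexOn_exp.2 (Set.mem_univ (c * s)) (Set.mem_univ (-(c * s))) ha hb hab
  simp only [smul_eq_mul] at hconv
  have harg : (c + u) / (2 * c) * (c * s) + (c - u) / (2 * c) * (-(c * s)) = u * s := by
    field_simp; ring
  rw [harg] at hconv
  have hchord : (c + u) / (2 * c) * Real.exp (c * s) + (c - u) / (2 * c) * Real.exp (-(c * s)) =
      Real.cosh (c * s) + u * (Real.sinh (c * s) / c) := by
    rw [Real.cosh_eq, Real.sinh_eq]; field_simp; ring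
  rw [hchord] at hconv
  have hcosh := Real.cosh_le_exp_half_sq (c * s)
  have hsq : (c * s) ^ 2 / 2 = c ^ 2 / 2 * s ^ 2 := by ring
  rw [hsq] at hcosh
  have hinv : Real.exp (c ^ 2 / 2 * s ^ 2) * Real.exp (-(c ^ 2 / 2 * s ^ 2)) = 1 := by
    rw [← Real.exp_add]; simp
  rw [sub_eq_add_neg, Real.exp_add]
  calc _ ≤ (Real.exp (c ^ 2 / 2 * s ^ 2) + u * (Real.sinh (c * s) / c)) *
        Real.exp (-(c ^ 2 / 2 * s ^ 2)) := by gcongr; linarith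
    _ = _ := by rw [add_mul, hinv]; ring

section Noise

variable {Ω : Type*} {m0 : MeasurableSpace Ω}

lemma integral_mul_eq_zero_of_condExp_eq_zero {P : Measure Ω} [IsFiniteMeasure P]
    {m : MeasurableSpace Ω} (hm : m ≤ m0) {f ξ : Ω → ℝ} (hf : Measurable[m] f) {b : ℝ}
    (hb : ∀ᵐ ω ∂P, |f ω| ≤ b) (hξ : Integrable ξ P) (hcond : P[ξ|m] =ᵐ[P] 0) :
    ∫ ω, f ω * ξ ω ∂P = 0 := by
  have h := condExp_stronglyMeasurable_mul_of_bound hm hf.stronglyMeasurable hξ b hb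
  have h2 := integral_condExp (μ := P) hm (f := f * ξ)
  rw [show ∫ ω, f ω * ξ ω ∂P = ∫ ω, (f * ξ) ω ∂P from rfl, ← h2, integral_congr_ae h]
  rw [integral_congr_ae (g := fun _ => 0)]
  · simp
  · filter_upwards [hcond] with ω hω
    simp [hω]

/-- The Hoeffding-compensated sum of the noise `ξ` against the predictable weights `w`. -/
noncomputable def compensatedSum (c : ℝ) (ξ w : ℕ → Ω → ℝ) (n : ℕ) (ω : Ω) : ℝ :=
  ∑ k ∈ Finset.range n, (ξ k ω * w k ω - c ^ 2 / 2 * w k ω ^ 2)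

lemma measurable_compensatedSum {F : Filtration ℕ m0} {c : ℝ} {ξ w : ℕ → Ω → ℝ}
    (hξ : ∀ k, Measurable[F (k + 1)] (ξ k)) (hw : ∀ k, Measurable[F k] (w k)) (n : ℕ) :
    Measurable[F n] (compensatedSum c ξ w n) := by
  refine Finset.measurable_fun_sum _ fun k hk => ?_
  have hkn : k + 1 ≤ n := Finset.mem_range.1 hk
  have h1 := (hξ k).mono (F.mono hkn) le_rfl
  have h2 := (hw k).mono (F.mono (k.le_succ.trans hkn)) le_rfl
  exact (h1.mul h2).sub ((h2.pow_const 2).const_mul _)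

lemma integrable_exp_compensatedSum_and_integral_le_one {P : Measure Ω} [IsProbabilityMeasure P]
    {F : Filtration ℕ m0} {c B : ℝ} (hc : 0 < c) {ξ w : ℕ → Ω → ℝ}
    (hξ : ∀ k, Measurable[F (k + 1)] (ξ k)) (hξc : ∀ k, ∀ᵐ ω ∂P, |ξ k ω| ≤ c)
    (hcond : ∀ k, P[ξ k|F k] =ᵐ[P] 0)
    (hw : ∀ k, Measurable[F k] (w k)) (hwB : ∀ k ω, |w k ω| ≤ B) (n : ℕ) :
    Integrable (fun ω => Real.exp (compensatedSum c ξ w n ω)) P ∧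
      ∫ ω, Real.exp (compensatedSum c ξ w n ω) ∂P ≤ 1 := by
  have hbound : ∀ n, ∀ᵐ ω ∂P, Real.exp (compensatedSum c ξ w n ω) ≤ Real.exp (n * (c * B)) := by
    intro n
    filter_upwards [ae_all_iff.2 hξc] with ω hω
    refine Real.exp_le_exp.2 ?_
    calc compensatedSum c ξ w n ω ≤ ∑ k ∈ Finset.range n, c * B := by
          refine Finset.sum_le_sum fun k _ => ?_
          have h1 : ξ k ω * w k ω ≤ |ξ k ω| * |w k ω| := by
            rw [← abs_mul]; exact le_abs_self _
          have h2 : |ξ k ω| * |w k ω| ≤ c * B :=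
            mul_le_mul (hω k) (hwB k ω) (abs_nonneg _) hc.le
          have h3 : 0 ≤ c ^ 2 / 2 * w k ω ^ 2 := by positivity
          linarith
      _ = n * (c * B) := by simp
  have hint : ∀ n, Integrable (fun ω => Real.exp (compensatedSum c ξ w n ω)) P := by
    intro n
    refine Integrable.of_bound
      (((measurable_compensatedSum hξ hw n).mono (F.le n) le_rfl).exp.aestronglyMeasurable)
      (Real.exp (n * (c * B))) ?_
    filter_upwards [hbound n] with ω hω
    rwa [Real.norm_eq_abs, Real.abs_exp]
  refine ⟨hint n, ?_⟩
  induction n with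
  | zero => simp [compensatedSum]
  | succ n ih =>
    set f : Ω → ℝ := fun ω => Real.exp (compensatedSum c ξ w n ω) *
      (Real.sinh (c * w n ω) / c * Real.exp (-(c ^ 2 / 2 * w n ω ^ 2))) with hf
    have hfm : Measurable[F n] f := by
      have h1 := (measurable_compensatedSum (c := c) hξ hw n).exp
      have h2 : Measurable[F n] fun ω => Real.sinh (c * w n ω) / c *
          Real.exp (-(c ^ 2 / 2 * w n ω ^ 2)) := by
        refine Measurable.mul ?_ ?_
        · exact (Real.measurable_sinh.comp ((hw n).const_mul c)).div_const c
        · exact (((hw n).pow_const 2).const_mul _).neg.exp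
      exact h1.mul h2
    have hfb : ∀ᵐ ω ∂P, |f ω| ≤ Real.exp (n * (c * B)) * (Real.sinh (c * B) / c) := by
      filter_upwards [hbound n] with ω hω
      rw [hf]
      simp only [abs_mul, Real.abs_exp, abs_div, Real.abs_sinh, abs_of_pos hc]
      refine mul_le_mul hω ?_ (by positivity) (Real.exp_nonneg _)
      have h1 : Real.exp (-(c ^ 2 / 2 * w n ω ^ 2)) ≤ 1 :=
        Real.exp_le_one_iff.2 (neg_nonpos.2 (by positivity))
      have h2 : Real.sinh (c * |w n ω|) / c ≤ Real.sinh (c * B) / c := by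
        have := Real.sinh_le_sinh.2 (mul_le_mul_of_nonneg_left (hwB n ω) hc.le)
        gcongr
      have h3 : 0 ≤ Real.sinh (c * |w n ω|) / c :=
        div_nonneg (Real.sinh_nonneg_iff.2 (by positivity)) hc.le
      calc _ ≤ Real.sinh (c * |w n ω|) / c * 1 := mul_le_mul_of_nonneg_left h1 h3
        _ ≤ _ := by linarith
    have hξint : Integrable (ξ n) P :=
      Integrable.of_bound ((hξ n).mono (F.le _) le_rfl).aestronglyMeasurable c (hξc n)
    have hfξ : Integrable (fun ω => f ω * ξ n ω) P :=
      hξint.bdd_mul (hfm.mono (F.le n) le_rfl).aestronglyMeasurable hfb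
    have hzero := integral_mul_eq_zero_of_condExp_eq_zero (F.le n) hfm hfb hξint (hcond n)
    calc ∫ ω, Real.exp (compensatedSum c ξ w (n + 1) ω) ∂P
        ≤ ∫ ω, (Real.exp (compensatedSum c ξ w n ω) + f ω * ξ n ω) ∂P := by
          refine integral_mono_ae (hint (n + 1)) ((hint n).add hfξ) ?_
          filter_upwards [hξc n] with ω hω
          have h := exp_mul_sub_sq_le hc hω (w n ω)
          simp only [hf]
          rw [compensatedSum, Finset.sum_range_succ, Real.exp_add]
          refine (mul_le_mul_of_nonneg_left h (Real.exp_nonneg _)).trans_eq ?_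
          rw [compensatedSum]; ring
      _ = ∫ ω, Real.exp (compensatedSum c ξ w n ω) ∂P := by
          rw [integral_add (hint n) hfξ, hzero, add_zero]
      _ ≤ 1 := ih

open Classical in
/-- Time-uniform deviation bound, of the type of Ville's inequality. The weights are set to zero
once the level `ε` has been crossed, which reduces the maximum to the terminal value. -/
lemma measure_exists_le_compensatedSum_le {P : Measure Ω} [IsProbabilityMeasure P]
    {F : Filtration ℕ m0} {c B : ℝ} (hc : 0 < c) (hB : 0 ≤ B) {ξ w : ℕ → Ω → ℝ}
    (hξ : ∀ k, Measurable[F (k + 1)] (ξ k)) (hξc : ∀ k, ∀ᵐ ω ∂P, |ξ k ω| ≤ c)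
    (hcond : ∀ k, P[ξ k|F k] =ᵐ[P] 0)
    (hw : ∀ k, Measurable[F k] (w k)) (hwB : ∀ k ω, |w k ω| ≤ B) (ε : ℝ) :
    P {ω | ∃ n, ε ≤ compensatedSum c ξ w n ω} ≤ ENNReal.ofReal (Real.exp (-ε)) := by
  set A : ℕ → Set Ω := fun k => {ω | ∀ j ≤ k, compensatedSum c ξ w j ω < ε} with hA
  set w' : ℕ → Ω → ℝ := fun k => (A k).indicator (w k) with hw'
  have hAm : ∀ k, MeasurableSet[F k] (A k) := by
    intro k
    have : A k = ⋂ j ∈ Set.Iic k, {ω | compensatedSum c ξ w j ω < ε} := by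
      ext ω; simp [hA]
    rw [this]
    refine MeasurableSet.biInter (Set.to_countable _) fun j hj => ?_
    exact ((measurable_compensatedSum hξ hw j).mono (F.mono hj) le_rfl) measurableSet_Iio
  have hw'm : ∀ k, Measurable[F k] (w' k) := fun k => (hw k).indicator (hAm k)
  have hw'B : ∀ k ω, |w' k ω| ≤ B := by
    intro k ω
    by_cases h : ω ∈ A k
    · simpa [hw', h] using hwB k ω
    · simpa [hw', h] using hB
  have hcross : ∀ N ω, (∃ n ≤ N, ε ≤ compensatedSum c ξ w n ω) →
      ε ≤ compensatedSum c ξ w' N ω := by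
    rintro N ω ⟨n₀, hn₀, hε₀⟩
    have hex : ∃ n, ε ≤ compensatedSum c ξ w n ω := ⟨n₀, hε₀⟩
    set n := Nat.find hex with hn
    have hnε := Nat.find_spec hex
    have hnN : n ≤ N := (Nat.find_min' hex hε₀).trans hn₀
    refine hnε.trans_eq ?_
    unfold compensatedSum
    rw [← Finset.sum_subset (Finset.range_mono hnN)]
    · refine Finset.sum_congr rfl fun k hk => ?_
      have hkA : ω ∈ A k := fun j hj =>
        not_le.1 (Nat.find_min hex (hj.trans_lt (Finset.mem_range.1 hk)))
      simp [hw', hkA]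
    · intro k _ hk
      have hkA : ω ∉ A k := fun h =>
        (h n (not_lt.1 (fun h' => hk (Finset.mem_range.2 h')))).not_ge hnε
      simp [hw', hkA]
  have hfin : ∀ N, P {ω | ∃ n ≤ N, ε ≤ compensatedSum c ξ w n ω} ≤
      ENNReal.ofReal (Real.exp (-ε)) := by
    intro N
    obtain ⟨hi, h1⟩ :=
      integrable_exp_compensatedSum_and_integral_le_one hc hξ hξc hcond hw'm hw'B N
    have hmk := mul_meas_ge_le_integral_of_nonneg
      (Filter.Eventually.of_forall fun ω => Real.exp_nonneg _) hi (Real.exp ε)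
    have hreal : P.real {ω | Real.exp ε ≤ Real.exp (compensatedSum c ξ w' N ω)} ≤
        Real.exp (-ε) := by
      rw [Real.exp_neg, ← one_div, le_div_iff₀ (Real.exp_pos _), mul_comm]
      exact hmk.trans h1
    calc P {ω | ∃ n ≤ N, ε ≤ compensatedSum c ξ w n ω}
        ≤ P {ω | Real.exp ε ≤ Real.exp (compensatedSum c ξ w' N ω)} :=
          measure_mono fun ω hω => Real.exp_le_exp.2 (hcross N ω hω)
      _ ≤ _ := by
          rw [← ENNReal.ofReal_toReal (measure_ne_top P _)]
          exact ENNReal.ofReal_le_ofReal hreal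
  have hun : {ω | ∃ n, ε ≤ compensatedSum c ξ w n ω} =
      ⋃ N, {ω | ∃ n ≤ N, ε ≤ compensatedSum c ξ w n ω} := by
    ext ω
    simp only [Set.mem_ofPred_eq, Set.mem_iUnion]
    exact ⟨fun ⟨n, hn⟩ => ⟨n, n, le_rfl, hn⟩, fun ⟨_, n, _, hn⟩ => ⟨n, hn⟩⟩
  have hmono : Monotone fun N => {ω | ∃ n ≤ N, ε ≤ compensatedSum c ξ w n ω} :=
    fun N M hNM ω ⟨n, hn, h⟩ => ⟨n, hn.trans hNM, h⟩
  rw [hun, hmono.measure_iUnion]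
  exact iSup_le hfin

end Noise

section Deterministic

variable {ι : Type*} [Fintype ι]

lemma abs_dotProduct_le {u v : ι → ℝ} {a : ℝ} (hu : √(∑ j, u j ^ 2) ≤ a)
    (hv : √(∑ j, v j ^ 2) ≤ 1) : |u ⬝ᵥ v| ≤ a := by
  have h0 : ∀ f : ι → ℝ, 0 ≤ ∑ j, f j ^ 2 := fun f => Finset.sum_nonneg fun j _ => sq_nonneg _
  have h := Real.abs_le_sqrt (Finset.sum_mul_sq_le_sq_mul_sq Finset.univ u v)
  rw [Real.sqrt_mul (h0 u)] at h
  calc |u ⬝ᵥ v| ≤ _ := h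
    _ ≤ √(∑ j, u j ^ 2) * 1 := by gcongr
    _ ≤ a := by simpa using hu

lemma setOf_sqrt_sum_sq_le_eq_preimage (D : ℝ) :
    {v : ι → ℝ | √(∑ j, v j ^ 2) ≤ D} =
      (WithLp.toLp 2 : (ι → ℝ) → EuclideanSpace ℝ ι) ⁻¹' Metric.closedBall 0 D := by
  ext v
  simp [EuclideanSpace.norm_eq]

lemma convex_setOf_sqrt_sum_sq_le (D : ℝ) : Convex ℝ {v : ι → ℝ | √(∑ j, v j ^ 2) ≤ D} := by
  rw [setOf_sqrt_sum_sq_le_eq_preimage]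
  exact (convex_closedBall _ _).linear_preimage (WithLp.linearEquiv 2 ℝ (ι → ℝ)).symm.toLinearMap

lemma isCompact_setOf_sqrt_sum_sq_le (D : ℝ) :
    IsCompact {v : ι → ℝ | √(∑ j, v j ^ 2) ≤ D} := by
  rw [setOf_sqrt_sum_sq_le_eq_preimage]
  exact (EuclideanSpace.equiv ι ℝ).symm.toHomeomorph.isCompact_preimage.2
    (isCompact_closedBall _ _)

lemma Matrix.PosDef.dotProduct_mulVec_comm {A : Matrix ι ι ℝ} (hA : A.PosDef) (u v : ι → ℝ) :
    u ⬝ᵥ (A *ᵥ v) = v ⬝ᵥ (A *ᵥ u) := by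
  have h : Aᵀ = A := by simpa using hA.isHermitian.eq
  rw [dotProduct_mulVec, ← mulVec_transpose, h, dotProduct_comm]

lemma Matrix.PosDef.dotProduct_mulVec_self_nonneg {A : Matrix ι ι ℝ} (hA : A.PosDef)
    (u : ι → ℝ) : 0 ≤ u ⬝ᵥ (A *ᵥ u) := by
  simpa using hA.posSemidef.dotProduct_mulVec_nonneg u

/-- A minimizer over a convex set of a strongly convex quadratic leaves a quadratic gap. -/
lemma quadratic_gap_of_isMinOn {A : Matrix ι ι ℝ} (hA : A.PosDef) {K : Set (ι → ℝ)}
    (hK : Convex ℝ K) {a b u v : ι → ℝ} (hu : u ∈ K) (hv : v ∈ K)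
    (hmin : ∀ v ∈ K, 1 / 2 * ((u - a) ⬝ᵥ (A *ᵥ (u - a))) + u ⬝ᵥ b ≤
      1 / 2 * ((v - a) ⬝ᵥ (A *ᵥ (v - a))) + v ⬝ᵥ b) :
    1 / 2 * ((u - a) ⬝ᵥ (A *ᵥ (u - a))) + u ⬝ᵥ b + 1 / 2 * ((v - u) ⬝ᵥ (A *ᵥ (v - u))) ≤
      1 / 2 * ((v - a) ⬝ᵥ (A *ᵥ (v - a))) + v ⬝ᵥ b := by
  set p := u - a with hp
  set q := v - u with hq
  have hva : v - a = p + q := by simp [hp, hq]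
  have hvb : v ⬝ᵥ b = u ⬝ᵥ b + q ⬝ᵥ b := by rw [← add_dotProduct]; simp [hq]
  have hexp : ∀ s : ℝ, (p + s • q) ⬝ᵥ (A *ᵥ (p + s • q)) =
      p ⬝ᵥ (A *ᵥ p) + 2 * s * (p ⬝ᵥ (A *ᵥ q)) + s ^ 2 * (q ⬝ᵥ (A *ᵥ q)) := by
    intro s
    simp only [mulVec_add, mulVec_smul, add_dotProduct, dotProduct_add, smul_dotProduct,
      dotProduct_smul, smul_eq_mul, hA.dotProduct_mulVec_comm q p]
    ring
  have hQ := hA.dotProduct_mulVec_self_nonneg q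
  have hfirst : 0 ≤ p ⬝ᵥ (A *ᵥ q) + q ⬝ᵥ b := by
    by_contra! hneg
    set r := p ⬝ᵥ (A *ᵥ q) + q ⬝ᵥ b with hr
    set Q := q ⬝ᵥ (A *ᵥ q) with hQdef
    have hstep : ∀ s : ℝ, 0 < s → s ≤ 1 → 0 ≤ r + s / 2 * Q := by
      intro s hs hs1
      have hmem : u + s • q ∈ K := by
        have := hK hu hv (a := 1 - s) (b := s) (by linarith) hs.le (by ring)
        convert this using 1
        rw [hq, smul_sub, sub_smul, one_smul]; abel
      have h := hmin _ hmem
      rw [show u + s • q - a = p + s • q by rw [hp]; abel, hexp, add_dotProduct,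
        smul_dotProduct, smul_eq_mul] at h
      have h2 : 0 ≤ s * (r + s / 2 * Q) := by rw [hr]; nlinarith
      exact nonneg_of_mul_nonneg_right h2 hs
    have hpos : 0 < Q - r := by linarith
    have h := hstep (-r / (Q - r)) (div_pos (by linarith) hpos)
      ((div_le_one hpos).2 (by linarith))
    have h' : r + -r / (Q - r) / 2 * Q < 0 := by
      have : -r / (Q - r) * Q ≤ -r := by
        rw [div_mul_eq_mul_div, div_le_iff₀ hpos]; nlinarith
      linarith
    linarith
  have h1 := hexp 1
  rw [one_smul] at h1
  rw [hva, hvb, h1]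
  linarith

/-- One projected Newton step, compared with a point of the constraint set. -/
lemma projected_newton_step_le [DecidableEq ι] {A : Matrix ι ι ℝ} (hA : A.PosDef)
    {K : Set (ι → ℝ)} (hK : Convex ℝ K) {a b u v : ι → ℝ} (hu : u ∈ K) (hv : v ∈ K)
    (hmin : ∀ v ∈ K, 1 / 2 * ((u - a) ⬝ᵥ (A *ᵥ (u - a))) + u ⬝ᵥ b ≤
      1 / 2 * ((v - a) ⬝ᵥ (A *ᵥ (v - a))) + v ⬝ᵥ b) :
    (v - u) ⬝ᵥ (A *ᵥ (v - u)) ≤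
      (v - a) ⬝ᵥ (A *ᵥ (v - a)) - 2 * ((a - v) ⬝ᵥ b) + b ⬝ᵥ (A⁻¹ *ᵥ b) := by
  have hgap := quadratic_gap_of_isMinOn hA hK hu hv hmin
  have hAA : A *ᵥ (A⁻¹ *ᵥ b) = b := by
    rw [mulVec_mulVec, mul_nonsing_inv _ ((isUnit_iff_isUnit_det A).1 hA.isUnit), one_mulVec]
  have hsq := hA.dotProduct_mulVec_self_nonneg (u - a + A⁻¹ *ᵥ b)
  rw [mulVec_add, dotProduct_add, add_dotProduct, add_dotProduct,
    hA.dotProduct_mulVec_comm (A⁻¹ *ᵥ b) (u - a), hAA] at hsq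
  have h1 : (u - a) ⬝ᵥ b = u ⬝ᵥ b - a ⬝ᵥ b := sub_dotProduct _ _ _
  have h2 : (a - v) ⬝ᵥ b = a ⬝ᵥ b - v ⬝ᵥ b := sub_dotProduct _ _ _
  rw [dotProduct_comm (A⁻¹ *ᵥ b) b] at hsq
  linarith

lemma mul_dotProduct_inv_mulVec_le_log_det_ratio [DecidableEq ι] {A B : Matrix ι ι ℝ}
    (hA : A.PosDef) (hB : B.PosDef) {c : ℝ} {x : ι → ℝ} (hAB : B = A + c • vecMulVec x x) :
    c * (x ⬝ᵥ (B⁻¹ *ᵥ x)) ≤ Real.log B.det - Real.log A.det := by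
  have hdet : A.det = B.det * (1 - c * (x ⬝ᵥ (B⁻¹ *ᵥ x))) := by
    have hA' : A = B + replicateCol Unit (-c • x) * replicateRow Unit x := by
      rw [← vecMulVec_eq, hAB, smul_vecMulVec, neg_smul]; abel
    rw [hA', det_add_replicateCol_mul_replicateRow ((isUnit_iff_isUnit_det B).1 hB.isUnit)]
    congr 1
    rw [det_unique, Matrix.add_apply, Matrix.one_apply_eq, Matrix.mul_assoc, ← replicateCol_mulVec,
      replicateRow_mul_replicateCol_apply, mulVec_smul, dotProduct_smul, smul_eq_mul]
    ring
  have hpos : 0 < 1 - c * (x ⬝ᵥ (B⁻¹ *ᵥ x)) := by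
    have := hA.det_pos
    rw [hdet] at this
    exact pos_of_mul_pos_right this hB.det_pos.le
  rw [hdet, Real.log_mul hB.det_pos.ne' hpos.ne']
  have := Real.log_le_sub_one_of_pos hpos
  linarith

lemma dotProduct_vecMulVec_self_mulVec (c : ℝ) (v x : ι → ℝ) :
    v ⬝ᵥ ((c • vecMulVec x x) *ᵥ v) = c * (v ⬝ᵥ x) ^ 2 := by
  rw [smul_mulVec, vecMulVec_mulVec, dotProduct_smul, dotProduct_smul, dotProduct_comm x v]
  simp [sq]

end Deterministic

/-- The derivative of a convex function which is strongly monotone on the open interval is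
strongly monotone on the closed one. -/
lemma mul_sub_sq_le_of_deriv_ge {μ μ' : ℝ → ℝ} {D κ : ℝ} (hmono : Monotone μ)
    (hder : ∀ z ∈ Set.Ioo (-D) D, HasDerivAt μ (μ' z) z)
    (hge : ∀ z ∈ Set.Ioo (-D) D, κ ≤ μ' z) {a b : ℝ} (ha : a ∈ Set.Icc (-D) D)
    (hb : b ∈ Set.Icc (-D) D) : κ * (a - b) ^ 2 ≤ (μ a - μ b) * (a - b) := by
  have key : ∀ a ∈ Set.Icc (-D) D, ∀ b ∈ Set.Icc (-D) D, a < b → κ * (b - a) ≤ μ b - μ a := by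
    intro a ha b hb hab
    have hinner : ∀ s ∈ Set.Ioo (0 : ℝ) ((b - a) / 2), κ * (b - a - 2 * s) ≤ μ b - μ a := by
      intro s hs
      have hs2 : 2 * s < b - a := by linarith [hs.2]
      have hmem : ∀ z ∈ Set.Icc (a + s) (b - s), z ∈ Set.Ioo (-D) D := fun z hz =>
        ⟨by linarith [hz.1, ha.1, hs.1], by linarith [hz.2, hb.2, hs.1]⟩
      obtain ⟨z, hz, hzeq⟩ := exists_hasDerivAt_eq_slope μ μ' (a := a + s) (b := b - s)
        (by linarith) (fun z hz => (hder z (hmem z hz)).continuousAt.continuousWithinAt)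
        (fun z hz => hder z (hmem z (Set.Ioo_subset_Icc_self hz)))
      have h := hge z (hmem z (Set.Ioo_subset_Icc_self hz))
      rw [hzeq, le_div_iff₀ (by linarith)] at h
      have h1 := hmono (show a ≤ a + s by linarith [hs.1])
      have h2 := hmono (show b - s ≤ b by linarith [hs.1])
      linarith
    have hlim : Filter.Tendsto (fun s : ℝ => κ * (b - a - 2 * s)) (nhdsWithin 0 (Set.Ioi 0))
        (nhds (κ * (b - a))) := by
      have : Continuous fun s : ℝ => κ * (b - a - 2 * s) := by fun_prop
      have := this.tendsto 0
      simp only [mul_zero, sub_zero] at this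
      exact this.mono_left nhdsWithin_le_nhds
    refine le_of_tendsto hlim ?_
    filter_upwards [Ioo_mem_nhdsGT (show (0 : ℝ) < (b - a) / 2 by linarith)] with s hs
    exact hinner s hs
  rcases lt_trichotomy a b with h | h | h
  · have := key a ha b hb h
    nlinarith
  · simp [h]
  · have := key b hb a ha h
    nlinarith

lemma measurable_of_unique_isMinOn {Ω X E : Type*} [MeasurableSpace Ω] [TopologicalSpace X]
    [MeasurableSpace X] [OpensMeasurableSpace X] [TopologicalSpace E] [T2Space E]
    [MeasurableSpace E] [BorelSpace E] {K : Set E} (hK : IsCompact K) {f : X → E → ℝ}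
    (hf : Continuous fun q : X × E => f q.1 q.2) {p : Ω → X} (hp : Measurable p) {v : Ω → E}
    (hvK : ∀ ω, v ω ∈ K) (hmin : ∀ ω, ∀ u ∈ K, f (p ω) (v ω) ≤ f (p ω) u)
    (huniq : ∀ ω, ∀ u ∈ K, (∀ u' ∈ K, f (p ω) u ≤ f (p ω) u') → u = v ω) :
    Measurable v := by
  refine measurable_of_isClosed fun C hC => ?_
  have := isCompact_iff_compactSpace.1 hK
  set S : Set (X × K) := {q | (q.2 : E) ∈ C ∧ ∀ u' ∈ K, f q.1 q.2 ≤ f q.1 u'} with hS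
  have hSc : IsClosed S := by
    refine (hC.preimage (by fun_prop)).inter ?_
    have : {q : X × K | ∀ u' ∈ K, f q.1 q.2 ≤ f q.1 u'} =
        ⋂ u' ∈ K, {q : X × K | f q.1 q.2 ≤ f q.1 u'} := by ext; simp
    change IsClosed {q : X × K | ∀ u' ∈ K, f q.1 q.2 ≤ f q.1 u'}
    rw [this]
    refine isClosed_biInter fun u' _ => isClosed_le ?_ ?_
    · exact hf.comp (f := fun q : X × K => (q.1, (q.2 : E))) (by fun_prop)
    · exact hf.comp (f := fun q : X × K => (q.1, u')) (by fun_prop)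
  have hpre : v ⁻¹' C = p ⁻¹' (Prod.fst '' S) := by
    ext ω
    constructor
    · intro h
      exact ⟨(p ω, ⟨v ω, hvK ω⟩), ⟨h, hmin ω⟩, rfl⟩
    · rintro ⟨⟨q, u⟩, ⟨huC, hu⟩, hq⟩
      obtain rfl : q = p ω := hq
      have := huniq ω u u.2 hu
      simpa [← this] using huC
  rw [hpre]
  exact hp (isClosedMap_fst_of_compactSpace _ hSc).measurableSet

lemma measurable_projected_newton_step {Ω ι : Type*} {_ : MeasurableSpace Ω} [Fintype ι]
    {K : Set (ι → ℝ)} (hK : IsCompact K) (hKconv : Convex ℝ K) {a b u : Ω → ι → ℝ}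
    {A : Ω → Matrix ι ι ℝ} (hA : ∀ ω, (A ω).PosDef) (ha : Measurable a)
    (hAm : ∀ i j, Measurable fun ω => A ω i j) (hb : Measurable b) (hu : ∀ ω, u ω ∈ K)
    (hmin : ∀ ω, ∀ v ∈ K,
      1 / 2 * ((u ω - a ω) ⬝ᵥ (A ω *ᵥ (u ω - a ω))) + u ω ⬝ᵥ b ω ≤
        1 / 2 * ((v - a ω) ⬝ᵥ (A ω *ᵥ (v - a ω))) + v ⬝ᵥ b ω) :
    Measurable u := by
  refine measurable_of_unique_isMinOn (X := (ι → ℝ) × (ι → ι → ℝ) × (ι → ℝ))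
    (f := fun q v => 1 / 2 * ((v - q.1) ⬝ᵥ (Matrix.of q.2.1 *ᵥ (v - q.1))) + v ⬝ᵥ q.2.2)
    (p := fun ω => (a ω, fun i j => A ω i j, b ω)) hK ?_ ?_ hu hmin ?_
  · simp only [dotProduct, mulVec, of_apply, Pi.sub_apply]
    fun_prop
  · exact ha.prodMk ((measurable_pi_lambda _ fun i => measurable_pi_lambda _ (hAm i)).prodMk hb)
  · intro ω v hv hvmin
    have hgap := quadratic_gap_of_isMinOn (hA ω) hKconv (hu ω) hv (hmin ω)
    have hle : 1 / 2 * ((v - a ω) ⬝ᵥ (A ω *ᵥ (v - a ω))) + v ⬝ᵥ b ω ≤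
      1 / 2 * ((u ω - a ω) ⬝ᵥ (A ω *ᵥ (u ω - a ω))) + u ω ⬝ᵥ b ω := hvmin (u ω) (hu ω)
    by_contra hne
    have hpos := (hA ω).dotProduct_mulVec_pos (sub_ne_zero.2 hne)
    rw [star_trivial] at hpos
    linarith

/-- Pathwise regret-type bound for projected Newton steps with rank-one updates. -/
lemma projected_newton_path_le {ι : Type*} [Fintype ι] [DecidableEq ι] {κ c : ℝ} (hκ : 0 < κ)
    {K : Set (ι → ℝ)} (hK : Convex ℝ K) {v : ι → ℝ} (hv : v ∈ K) {Z : ℕ → Matrix ι ι ℝ}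
    {x u : ℕ → ι → ℝ} {r ξ : ℕ → ℝ} (hZ : ∀ k, (Z k).PosDef)
    (hZrec : ∀ k, Z (k + 1) = Z k + (κ / 2) • vecMulVec (x k) (x k))
    (hu : ∀ k, u (k + 1) ∈ K)
    (hmin : ∀ k, ∀ v ∈ K,
      1 / 2 * ((u (k + 1) - u k) ⬝ᵥ (Z (k + 1) *ᵥ (u (k + 1) - u k))) +
          u (k + 1) ⬝ᵥ (r k • x k) ≤
        1 / 2 * ((v - u k) ⬝ᵥ (Z (k + 1) *ᵥ (v - u k))) + v ⬝ᵥ (r k • x k))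
    (hr : ∀ k, |r k| ≤ c)
    (hmono : ∀ k, κ * ((u k - v) ⬝ᵥ x k) ^ 2 - ξ k * ((u k - v) ⬝ᵥ x k) ≤
      r k * ((u k - v) ⬝ᵥ x k)) (n : ℕ) :
    (v - u n) ⬝ᵥ (Z n *ᵥ (v - u n)) ≤ (v - u 0) ⬝ᵥ (Z 0 *ᵥ (v - u 0)) +
      ∑ k ∈ Finset.range n,
        (2 * ξ k * ((u k - v) ⬝ᵥ x k) - 3 * κ / 2 * ((u k - v) ⬝ᵥ x k) ^ 2) +
      2 * c ^ 2 / κ * (Real.log (Z n).det - Real.log (Z 0).det) := by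
  induction n with
  | zero => simp
  | succ n ih =>
    have hstep := projected_newton_step_le (hZ (n + 1)) hK (hu n) hv (hmin n)
    have hdet := mul_dotProduct_inv_mulVec_le_log_det_ratio (hZ n) (hZ (n + 1)) (hZrec n)
    have hquad : (v - u n) ⬝ᵥ (Z (n + 1) *ᵥ (v - u n)) =
        (v - u n) ⬝ᵥ (Z n *ᵥ (v - u n)) + κ / 2 * ((u n - v) ⬝ᵥ x n) ^ 2 := by
      rw [hZrec, add_mulVec, dotProduct_add, dotProduct_vecMulVec_self_mulVec,
        ← neg_sub (u n) v, neg_dotProduct (u n - v) (x n), neg_sq]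
    have hnonneg : 0 ≤ x n ⬝ᵥ ((Z (n + 1))⁻¹ *ᵥ x n) :=
      (hZ (n + 1)).inv.dotProduct_mulVec_self_nonneg _
    have hgrad : (r n • x n) ⬝ᵥ ((Z (n + 1))⁻¹ *ᵥ (r n • x n)) ≤
        2 * c ^ 2 / κ * (Real.log (Z (n + 1)).det - Real.log (Z n).det) := by
      calc _ = r n ^ 2 * (x n ⬝ᵥ ((Z (n + 1))⁻¹ *ᵥ x n)) := by
            rw [mulVec_smul, smul_dotProduct, dotProduct_smul, smul_eq_mul, smul_eq_mul]; ring
        _ ≤ c ^ 2 * (x n ⬝ᵥ ((Z (n + 1))⁻¹ *ᵥ x n)) :=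
            mul_le_mul_of_nonneg_right (sq_le_sq.2 ((hr n).trans (le_abs_self c))) hnonneg
        _ = 2 * c ^ 2 / κ * (κ / 2 * (x n ⬝ᵥ ((Z (n + 1))⁻¹ *ᵥ x n))) := by
            field_simp
        _ ≤ _ := mul_le_mul_of_nonneg_left hdet (by positivity)
    rw [hquad, dotProduct_smul, smul_eq_mul] at hstep
    rw [Finset.sum_range_succ]
    have := hmono n
    linarith

/-- Theorem 1 of the paper.
The confidence ellipsoids built by MOGLB-UCB around the online-Newton-step
estimators contain the true coefficient vectors of all `m` objectives,
uniformly over time, with probability at least `1 - δ`. -/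
theorem moglb_confidence_sets
    (d m : ℕ) (hd : 1 ≤ d) (hm : 1 ≤ m)
    (D R U κ L lam δ : ℝ) (hD : 0 < D) (hR : 0 < R) (hU : 0 < U) (hκ : 0 < κ)
    (hL : 0 < L) (hlam : max 1 (κ / 2) ≤ lam) (hδ : δ ∈ Set.Ioo (0 : ℝ) 1)
    {Ω : Type*} {m0 : MeasurableSpace Ω} (P : Measure Ω) [IsProbabilityMeasure P]
    (F : Filtration ℕ m0)
    (g μ μ' : Fin m → ℝ → ℝ)
    (hg_conv : ∀ i, ConvexOn ℝ Set.univ (g i))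
    (hg_deriv : ∀ i, ∀ z : ℝ, HasDerivAt (g i) (μ i z) z)
    (hμ_deriv : ∀ i, ∀ z ∈ Set.Ioo (-D) D, HasDerivAt (μ i) (μ' i z) z)
    (hμ'_ge : ∀ i, ∀ z ∈ Set.Ioo (-D) D, κ ≤ μ' i z)
    (hμ_bdd : ∀ i, ∀ z ∈ Set.Icc (-D) D, |μ i z| ≤ U)
    (θ : Fin m → Fin d → ℝ) (hθ : ∀ i, Real.sqrt (∑ j, θ i j ^ 2) ≤ D)
    (x : ℕ → Ω → Fin d → ℝ)
    (hx_meas : ∀ t, 1 ≤ t → Measurable[F (t - 1)] (x t))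
    (hx_norm : ∀ t, 1 ≤ t → ∀ ω, Real.sqrt (∑ j, x t ω j ^ 2) ≤ 1)
    (y : ℕ → Fin m → Ω → ℝ)
    (hy_meas : ∀ t i, 1 ≤ t → Measurable[F t] (y t i))
    (hy_bdd : ∀ t i, 1 ≤ t → ∀ᵐ ω ∂P, |y t i ω| ≤ R)
    (hy_cond : ∀ t i, 1 ≤ t →
      P[y t i|F (t - 1)] =ᵐ[P] fun ω => μ i (θ i ⬝ᵥ x t ω))
    (Z : ℕ → Ω → Matrix (Fin d) (Fin d) ℝ)
    (hZ1 : ∀ ω, Z 1 ω = lam • (1 : Matrix (Fin d) (Fin d) ℝ))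
    (hZrec : ∀ t, 1 ≤ t → ∀ ω,
      Z (t + 1) ω = Z t ω + (κ / 2) • vecMulVec (x t ω) (x t ω))
    (θhat : ℕ → Fin m → Ω → Fin d → ℝ)
    (hθhat1 : ∀ i ω, θhat 1 i ω = 0)
    (hθhat_rec : ∀ t, 1 ≤ t → ∀ i ω,
      Real.sqrt (∑ j, θhat (t + 1) i ω j ^ 2) ≤ D ∧
      ∀ θ' : Fin d → ℝ, Real.sqrt (∑ j, θ' j ^ 2) ≤ D →
        1 / 2 * ((θhat (t + 1) i ω - θhat t i ω) ⬝ᵥ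
            (Z (t + 1) ω *ᵥ (θhat (t + 1) i ω - θhat t i ω))) +
          θhat (t + 1) i ω ⬝ᵥ ((μ i (θhat t i ω ⬝ᵥ x t ω) - y t i ω) • x t ω) ≤
        1 / 2 * ((θ' - θhat t i ω) ⬝ᵥ (Z (t + 1) ω *ᵥ (θ' - θhat t i ω))) +
          θ' ⬝ᵥ ((μ i (θhat t i ω ⬝ᵥ x t ω) - y t i ω) • x t ω))
    (γ : ℕ → Ω → ℝ)
    (hγ : ∀ t : ℕ, ∀ ω, γ (t + 1) ω =
      16 * (R + U) ^ 2 / κ * Real.log (m / δ * Real.sqrt (1 + 4 * D ^ 2 * t)) +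
        lam * D ^ 2 +
        2 * (R + U) ^ 2 / κ * Real.log ((Z (t + 1) ω).det / (Z 1 ω).det) + κ / 2) :
    ENNReal.ofReal (1 - δ) ≤
      P {ω | ∀ i : Fin m, ∀ t : ℕ,
        (θ i - θhat (t + 1) i ω) ⬝ᵥ (Z (t + 1) ω *ᵥ (θ i - θhat (t + 1) i ω)) ≤
          γ (t + 1) ω} := by
  set c := R + U with hc_def
  have hc : 0 < c := add_pos hR hU
  have hlam0 : 0 < lam := lt_of_lt_of_le one_pos ((le_max_left _ _).trans hlam)
  have hδ0 : 0 < δ := hδ.1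
  have hm0 : (0 : ℝ) < m := by exact_mod_cast hm
  set K : Set (Fin d → ℝ) := {v | √(∑ j, v j ^ 2) ≤ D} with hK
  have hKconv : Convex ℝ K := convex_setOf_sqrt_sum_sq_le D
  have hμ_mono : ∀ i, Monotone (μ i) := fun i => by
    have hd : deriv (g i) = μ i := funext fun z => (hg_deriv i z).deriv
    have := (hg_conv i).monotoneOn_deriv fun z _ => (hg_deriv i z).differentiableAt
    rwa [hd, monotoneOn_univ] at this
  have hZpos : ∀ k ω, (Z (k + 1) ω).PosDef := by
    intro k ω
    induction k with
    | zero => rw [hZ1]; exact PosDef.one.smul hlam0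
    | succ k ih =>
      rw [hZrec (k + 1) (by omega)]
      refine ih.add_posSemidef (PosSemidef.smul ?_ (by positivity))
      simpa using posSemidef_vecMulVec_self_star (x (k + 1) ω)
  have hθhatK : ∀ k i ω, θhat (k + 1) i ω ∈ K := by
    intro k i ω
    cases k with
    | zero => simp [hK, hθhat1, hD.le]
    | succ k => exact (hθhat_rec (k + 1) (by omega) i ω).1
  have hx : ∀ k, Measurable[F k] (x (k + 1)) := fun k => hx_meas (k + 1) (by omega)
  have hxe : ∀ k j, Measurable[F k] fun ω => x (k + 1) ω j := fun k j =>
    (measurable_pi_apply j).comp (hx k)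
  have hy : ∀ k i, Measurable[F (k + 1)] (y (k + 1) i) := fun k i => hy_meas _ i (by omega)
  have hinner : ∀ k, ∀ v : Ω → Fin d → ℝ, Measurable[F k] v →
      Measurable[F k] fun ω => v ω ⬝ᵥ x (k + 1) ω := fun k v hv =>
    Finset.measurable_fun_sum _ fun j _ => ((measurable_pi_apply j).comp hv).mul (hxe k j)
  have hZm : ∀ k a b, Measurable[F k] fun ω => Z (k + 1) ω a b := by
    intro k a b
    induction k with
    | zero => simp only [zero_add, hZ1]; exact measurable_const
    | succ k ih =>
      have h : (fun ω => Z (k + 1 + 1) ω a b) = fun ω =>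
          Z (k + 1) ω a b + κ / 2 * (x (k + 1) ω a * x (k + 1) ω b) := by
        funext ω
        rw [hZrec (k + 1) (by omega)]
        simp [vecMulVec_apply]
      rw [h]
      exact (ih.add (((hxe k a).mul (hxe k b)).const_mul _)).mono (F.mono k.le_succ) le_rfl
  have hθhatm : ∀ k i, Measurable[F k] (θhat (k + 1) i) := by
    intro k i
    induction k with
    | zero =>
      have h : θhat (0 + 1) i = fun _ => 0 := funext (hθhat1 i)
      rw [h]; exact measurable_const
    | succ k ih =>
      refine measurable_projected_newton_step
        (a := θhat (k + 1) i) (A := Z (k + 1 + 1))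
        (b := fun ω => (μ i (θhat (k + 1) i ω ⬝ᵥ x (k + 1) ω) - y (k + 1) i ω) • x (k + 1) ω)
        (isCompact_setOf_sqrt_sum_sq_le D) hKconv (hZpos (k + 1))
        (ih.mono (F.mono k.le_succ) le_rfl) (hZm (k + 1)) ?_
        (fun ω => (hθhat_rec (k + 1) (by omega) i ω).1)
        (fun ω => (hθhat_rec (k + 1) (by omega) i ω).2)
      have h1 := (((hμ_mono i).measurable.comp (hinner k _ ih)).mono
        (F.mono k.le_succ) le_rfl).sub (hy k i)
      exact h1.smul ((hx k).mono (F.mono k.le_succ) le_rfl)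
  set η := κ / (16 * c ^ 2) with hη
  have hη0 : 0 < η := by positivity
  set ξ : Fin m → ℕ → Ω → ℝ := fun i k ω => y (k + 1) i ω - μ i (θ i ⬝ᵥ x (k + 1) ω) with hξ
  set w : Fin m → ℕ → Ω → ℝ := fun i k ω => (θhat (k + 1) i ω - θ i) ⬝ᵥ x (k + 1) ω with hw
  have habs : ∀ v ∈ K, ∀ k ω, |v ⬝ᵥ x (k + 1) ω| ≤ D := fun v hv k ω =>
    abs_dotProduct_le hv (hx_norm (k + 1) (by omega) ω)
  have hμabs : ∀ i, ∀ v ∈ K, ∀ k ω, |μ i (v ⬝ᵥ x (k + 1) ω)| ≤ U := fun i v hv k ω =>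
    hμ_bdd i _ (abs_le.1 (habs v hv k ω))
  have hμm : ∀ i k, Measurable[F k] fun ω => μ i (θ i ⬝ᵥ x (k + 1) ω) := fun i k =>
    (hμ_mono i).measurable.comp (hinner k _ measurable_const)
  have hξm : ∀ i k, Measurable[F (k + 1)] (ξ i k) := fun i k =>
    (hy k i).sub ((hμm i k).mono (F.mono k.le_succ) le_rfl)
  have hres : ∀ i k, ∀ v ∈ K, ∀ᵐ ω ∂P, |y (k + 1) i ω - μ i (v ⬝ᵥ x (k + 1) ω)| ≤ c := by
    intro i k v hv
    filter_upwards [hy_bdd (k + 1) i (by omega)] with ω hω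
    exact (abs_sub _ _).trans (add_le_add hω (hμabs i v hv k ω))
  have hcond : ∀ i k, P[ξ i k|F k] =ᵐ[P] 0 := by
    intro i k
    have hyi : Integrable (y (k + 1) i) P :=
      Integrable.of_bound ((hy k i).mono (F.le _) le_rfl).aestronglyMeasurable R
        (hy_bdd (k + 1) i (by omega))
    have hμi : Integrable (fun ω => μ i (θ i ⬝ᵥ x (k + 1) ω)) P :=
      Integrable.of_bound ((hμm i k).mono (F.le _) le_rfl).aestronglyMeasurable U
        (Filter.Eventually.of_forall fun ω => hμabs i _ (hθ i) k ω)
    have h1 := condExp_sub hyi hμi (F k)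
    rw [condExp_of_stronglyMeasurable (F.le k) (hμm i k).stronglyMeasurable hμi] at h1
    have h2 : P[y (k + 1) i|F k] =ᵐ[P] fun ω => μ i (θ i ⬝ᵥ x (k + 1) ω) :=
      hy_cond (k + 1) i (by omega)
    refine h1.trans ?_
    filter_upwards [h2] with ω hω
    simp [hω]
  have hwm : ∀ i k, Measurable[F k] fun ω => 2 * η * w i k ω := fun i k =>
    (hinner k _ ((hθhatm k i).sub measurable_const)).const_mul _
  have hwB : ∀ i k ω, |2 * η * w i k ω| ≤ 2 * η * (2 * D) := by
    intro i k ω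
    rw [abs_mul, abs_of_pos (by positivity : 0 < 2 * η)]
    refine mul_le_mul_of_nonneg_left ?_ (by positivity)
    simp only [hw, sub_dotProduct]
    refine (abs_sub _ _).trans ?_
    linarith [habs _ (hθhatK k i ω) k ω, habs _ (hθ i) k ω]
  set Bad : Fin m → Set Ω := fun i =>
    {ω | ∃ n, Real.log (m / δ) ≤ compensatedSum c (ξ i) (fun k ω => 2 * η * w i k ω) n ω}
    with hBad
  have hBadP : ∀ i, P (Bad i) ≤ ENNReal.ofReal (δ / m) := by
    intro i
    have h := measure_exists_le_compensatedSum_le hc (by positivity : 0 ≤ 2 * η * (2 * D))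
      (hξm i) (fun k => hres i k _ (hθ i)) (hcond i) (hwm i) (hwB i) (Real.log (m / δ))
    rwa [← Real.log_inv, Real.exp_log (by positivity), inv_div] at h
  have hBadU : P (⋃ i, Bad i) ≤ ENNReal.ofReal δ := by
    calc P (⋃ i, Bad i) ≤ ∑ i, P (Bad i) := measure_iUnion_fintype_le _ _
      _ ≤ ∑ _i : Fin m, ENNReal.ofReal (δ / m) := Finset.sum_le_sum fun i _ => hBadP i
      _ = ENNReal.ofReal δ := by
        rw [Finset.sum_const, Finset.card_univ, Fintype.card_fin, nsmul_eq_mul,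
          ← ENNReal.ofReal_natCast, ← ENNReal.ofReal_mul hm0.le, mul_div_cancel₀ _ hm0.ne']
  set G : Set Ω := {ω | ∀ i : Fin m, ∀ t : ℕ,
        (θ i - θhat (t + 1) i ω) ⬝ᵥ (Z (t + 1) ω *ᵥ (θ i - θhat (t + 1) i ω)) ≤
          γ (t + 1) ω} with hG
  have hgood : ∀ᵐ ω ∂P, ω ∈ Gᶜ → ω ∈ ⋃ i, Bad i := by
    have hall : ∀ᵐ ω ∂P, ∀ i k, |y (k + 1) i ω| ≤ R :=
      ae_all_iff.2 fun i => ae_all_iff.2 fun k => hy_bdd (k + 1) i (by omega)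
    filter_upwards [hall] with ω hω
    contrapose!
    intro hnot
    rw [Set.notMem_compl_iff]
    intro i t
    have hsum : compensatedSum c (ξ i) (fun k ω => 2 * η * w i k ω) t ω < Real.log (m / δ) := by
      by_contra! h
      exact hnot (Set.mem_iUnion.2 ⟨i, t, h⟩)
    have hpath := projected_newton_path_le (Z := fun k => Z (k + 1) ω)
      (x := fun k => x (k + 1) ω) (u := fun k => θhat (k + 1) i ω) (v := θ i)
      (r := fun k => μ i (θhat (k + 1) i ω ⬝ᵥ x (k + 1) ω) - y (k + 1) i ω)
      (ξ := fun k => ξ i k ω) (c := c) hκ hKconv (hθ i) (fun k => hZpos k ω)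
      (fun k => hZrec (k + 1) (by omega) ω)
      (fun k => hθhat_rec (k + 1) (by omega) i ω |>.1)
      (fun k => hθhat_rec (k + 1) (by omega) i ω |>.2)
      (fun k => by
        rw [abs_sub_comm]
        exact (abs_sub _ _).trans (add_le_add (hω i k) (hμabs i _ (hθhatK k i ω) k ω)))
      (fun k => by
        have := mul_sub_sq_le_of_deriv_ge (hμ_mono i) (hμ_deriv i) (hμ'_ge i)
          (abs_le.1 (habs _ (hθhatK k i ω) k ω)) (abs_le.1 (habs _ (hθ i) k ω))
        simp only [hξ, sub_dotProduct]
        linarith) t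
    simp only [zero_add, hθhat1, sub_zero, hZ1] at hpath
    have hnoise : ∑ k ∈ Finset.range t, (2 * ξ i k ω * w i k ω - 3 * κ / 2 * w i k ω ^ 2) ≤
        16 * c ^ 2 / κ * Real.log (m / δ) := by
      calc _ ≤ ∑ k ∈ Finset.range t, 16 * c ^ 2 / κ * (ξ i k ω * (2 * η * w i k ω) -
            c ^ 2 / 2 * (2 * η * w i k ω) ^ 2) := by
            refine Finset.sum_le_sum fun k _ => ?_
            have h1 : 16 * c ^ 2 / κ * (ξ i k ω * (2 * η * w i k ω) -
                c ^ 2 / 2 * (2 * η * w i k ω) ^ 2) =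
                2 * ξ i k ω * w i k ω - κ / 8 * w i k ω ^ 2 := by
              rw [hη]; field_simp; ring
            rw [h1]
            nlinarith [mul_nonneg hκ.le (sq_nonneg (w i k ω))]
        _ = 16 * c ^ 2 / κ * compensatedSum c (ξ i) (fun k ω => 2 * η * w i k ω) t ω := by
            rw [← Finset.mul_sum]; rfl
        _ ≤ _ := mul_le_mul_of_nonneg_left hsum.le (by positivity)
    have hinit : θ i ⬝ᵥ ((lam • (1 : Matrix (Fin d) (Fin d) ℝ)) *ᵥ θ i) ≤ lam * D ^ 2 := by
      rw [smul_mulVec, one_mulVec, dotProduct_smul, smul_eq_mul]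
      refine mul_le_mul_of_nonneg_left ?_ hlam0.le
      have h := (Real.sqrt_le_left hD.le).1 (hθ i)
      simpa [dotProduct, sq] using h
    have hlog : Real.log (m / δ) ≤ Real.log (m / δ * √(1 + 4 * D ^ 2 * t)) := by
      refine Real.log_le_log (by positivity) (le_mul_of_one_le_right (by positivity) ?_)
      exact Real.one_le_sqrt.2 (le_add_of_nonneg_right (by positivity))
    have hlog' := mul_le_mul_of_nonneg_left hlog (by positivity : 0 ≤ 16 * c ^ 2 / κ)
    rw [hγ, Real.log_div (hZpos t ω).det_pos.ne' (hZpos 0 ω).det_pos.ne', hZ1]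
    linarith
  have hGc : P Gᶜ ≤ ENNReal.ofReal δ := (measure_mono_ae hgood).trans hBadU
  rw [ENNReal.ofReal_sub _ hδ0.le, ENNReal.ofReal_one, tsub_le_iff_right]
  calc (1 : ENNReal) = P (G ∪ Gᶜ) := by rw [Set.union_compl_self, measure_univ]
    _ ≤ P G + P Gᶜ := measure_union_le _ _
    _ ≤ P G + ENNReal.ofReal δ := by gcongr
end

section
/- Adopt the full setup of the MOGLB-UCB algorithm: d, m ≥ 1, D > 0, R > 0, U > 0, κ > 0, L > 0, λ ≥ max(1, κ/2), δ ∈ (0,1); a finite arm set X ⊆ {x ∈ ℝ^d : ‖x‖ ≤ 1}; for each objective i ∈ {1,…,m}, a convex function g_i : ℝ → ℝ with derivative μ_i = g_i' that is monotonically increasing, L-Lipschitz on [-D, D], satisfies μ_i'(z) ≥ κ on (-D, D) and |μ_i(z)| ≤ U on [-D, D]; true coefficients θ_i with ‖θ_i‖ ≤ D; at each round t the chosen arm x_t ∈ X is F_{t-1}-measurable, the reward y_t^i is F_t-measurable with |y_t^i| ≤ R and E[y_t^i | F_{t-1}] = μ_i(θ_iᵀx_t); the matrices Z_t, estimators θ̂_{t,i},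 and radii γ_t are as produced by the algorithm (Z_1 = λI_d, Z_{t+1} = Z_t + (κ/2)x_t x_tᵀ, online-Newton-step projected updates, γ_{t+1} = (16(R+U)²/κ)·log((m/δ)√(1+4D²t)) + λD² + (2(R+U)²/κ)·log(det Z_{t+1}/det Z_1) + κ/2); and each x_t belongs to the empirical Pareto front O_t, i.e., for every x ∈ X there exists j ∈ {1,…,m} with θ̂_{t,j}ᵀx_t + √γ_t·‖x_t‖_{Z_t⁻¹} ≥ θ̂_{t,j}ᵀx + √γ_t·‖x‖_{Z_t⁻¹}. Then with probability at least 1 - δ, the Pareto regret satisfies PR(T) = Σ_{t=1}^T Δx_t ≤ 4L·√( (dT/κ)·log(1 + κT/(2λd))·γ_{T+1} ). -/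
open Matrix MeasureTheory

/-- `v` is not dominated by `u` in the Pareto order: `v = u` or `v` strictly exceeds
`u` in some component. -/
def NotDominated {m : ℕ} (v u : Fin m → ℝ) : Prop :=
  v = u ∨ ∃ i, u i < v i

/-- The Pareto suboptimality gap of arm `x` with respect to arm set `X` and expected
reward map `μv`: the least `ε ≥ 0` such that `μv x + ε·1` is not dominated by the
expected reward of any arm in `X`. -/
noncomputable def paretoGap {m : ℕ} {A : Type*} (X : Set A) (μv : A → Fin m → ℝ)
    (x : A) : ℝ :=
  sInf {ε : ℝ | 0 ≤ ε ∧ ∀ x' ∈ X, NotDominated (fun i => μv x i + ε) (μv x')}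

section
variable {d : ℕ} {Z : Matrix (Fin d) (Fin d) ℝ}

theorem dotProduct_mulVec_comm_of_posDef (hZ : Z.PosDef) (a b : Fin d → ℝ) :
    a ⬝ᵥ (Z *ᵥ b) = b ⬝ᵥ (Z *ᵥ a) := by
  have h : Zᵀ = Z := by simpa using hZ.isHermitian.eq
  rw [dotProduct_mulVec, ← mulVec_transpose, h, dotProduct_comm]

theorem dotProduct_mulVec_nonneg_of_posDef (hZ : Z.PosDef) (a : Fin d → ℝ) :
    0 ≤ a ⬝ᵥ (Z *ᵥ a) := by
  simpa using hZ.posSemidef.dotProduct_mulVec_nonneg a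

theorem mulVec_inv_mulVec_of_posDef (hZ : Z.PosDef) (a : Fin d → ℝ) :
    Z *ᵥ (Z⁻¹ *ᵥ a) = a := by
  rw [mulVec_mulVec, mul_nonsing_inv _ ((isUnit_iff_isUnit_det _).1 hZ.isUnit), one_mulVec]

theorem two_mul_dotProduct_le_of_posDef (hZ : Z.PosDef) (a b : Fin d → ℝ) :
    2 * (a ⬝ᵥ b) ≤ a ⬝ᵥ (Z *ᵥ a) + b ⬝ᵥ (Z⁻¹ *ᵥ b) := by
  have h := dotProduct_mulVec_nonneg_of_posDef hZ (a - Z⁻¹ *ᵥ b)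
  have hs := dotProduct_mulVec_comm_of_posDef hZ (Z⁻¹ *ᵥ b) a
  rw [mulVec_sub, mulVec_inv_mulVec_of_posDef hZ, dotProduct_sub, sub_dotProduct,
    sub_dotProduct, hs, mulVec_inv_mulVec_of_posDef hZ, dotProduct_comm (Z⁻¹ *ᵥ b) b] at h
  linarith

theorem dotProduct_sq_le_of_posDef (hZ : Z.PosDef) (a b : Fin d → ℝ) :
    (a ⬝ᵥ b) ^ 2 ≤ (a ⬝ᵥ (Z *ᵥ a)) * (b ⬝ᵥ (Z⁻¹ *ᵥ b)) := by
  have h : ∀ r : ℝ, 0 ≤ (a ⬝ᵥ (Z *ᵥ a)) * (r * r) + (-2 * (a ⬝ᵥ b)) * r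
      + b ⬝ᵥ (Z⁻¹ *ᵥ b) := by
    intro r
    have := two_mul_dotProduct_le_of_posDef hZ (r • a) b
    simp only [mulVec_smul, smul_dotProduct, dotProduct_smul, smul_eq_mul] at this
    linarith
  have := discrim_le_zero h
  rw [discrim] at this
  linarith

/-- First-order optimality condition for the minimiser of a quadratic over a convex set. -/
theorem first_order_optimality {K : Set (Fin d → ℝ)} (hK : Convex ℝ K) (hZ : Z.PosDef)
    {a b c v : Fin d → ℝ} (ha : a ∈ K) (hc : c ∈ K)
    (hmin : ∀ a' ∈ K, 1 / 2 * ((a - b) ⬝ᵥ (Z *ᵥ (a - b))) + a ⬝ᵥ v ≤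
      1 / 2 * ((a' - b) ⬝ᵥ (Z *ᵥ (a' - b))) + a' ⬝ᵥ v) :
    0 ≤ (c - a) ⬝ᵥ (Z *ᵥ (a - b)) + (c - a) ⬝ᵥ v := by
  set p := (c - a) ⬝ᵥ (Z *ᵥ (a - b)) + (c - a) ⬝ᵥ v with hp
  set q := (c - a) ⬝ᵥ (Z *ᵥ (c - a)) with hq
  have key : ∀ r : ℝ, 0 < r → r ≤ 1 → 0 ≤ p + r / 2 * q := by
    intro r hr hr1
    have h := hmin (a + r • (c - a)) (hK.add_smul_sub_mem ha hc ⟨hr.le, hr1⟩)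
    have e : a + r • (c - a) - b = (a - b) + r • (c - a) := by abel
    have hs := dotProduct_mulVec_comm_of_posDef hZ (a - b) (c - a)
    rw [e] at h
    simp only [mulVec_add, mulVec_smul, add_dotProduct, dotProduct_add, smul_dotProduct,
      dotProduct_smul, smul_eq_mul] at h
    rw [hs] at h
    have : 0 ≤ r * (p + r / 2 * q) := by rw [hp, hq]; linarith
    exact nonneg_of_mul_nonneg_right this hr
  by_contra! hneg
  have hq0 : 0 ≤ q := dotProduct_mulVec_nonneg_of_posDef hZ _
  have h1 := key (min 1 (-p / (q + 1))) (lt_min one_pos (by apply div_pos <;> linarith))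
    (min_le_left _ _)
  have h2 : min 1 (-p / (q + 1)) * q ≤ -p / (q + 1) * q :=
    mul_le_mul_of_nonneg_right (min_le_right _ _) hq0
  have h3 : -p / (q + 1) * q ≤ -p := by
    rw [div_mul_eq_mul_div, div_le_iff₀ (by linarith)]; nlinarith
  linarith

theorem minimizer_unique {K : Set (Fin d → ℝ)} (hK : Convex ℝ K) (hZ : Z.PosDef)
    {a b c v : Fin d → ℝ} (ha : a ∈ K) (hc : c ∈ K)
    (hmin : ∀ a' ∈ K, 1 / 2 * ((a - b) ⬝ᵥ (Z *ᵥ (a - b))) + a ⬝ᵥ v ≤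
      1 / 2 * ((a' - b) ⬝ᵥ (Z *ᵥ (a' - b))) + a' ⬝ᵥ v)
    (hmin' : ∀ a' ∈ K, 1 / 2 * ((c - b) ⬝ᵥ (Z *ᵥ (c - b))) + c ⬝ᵥ v ≤
      1 / 2 * ((a' - b) ⬝ᵥ (Z *ᵥ (a' - b))) + a' ⬝ᵥ v) : c = a := by
  have h1 := first_order_optimality hK hZ ha hc hmin
  have h2 := first_order_optimality hK hZ hc ha hmin'
  by_contra hne
  have h3 := hZ.dotProduct_mulVec_pos (sub_ne_zero.2 hne)
  simp only [star_trivial] at h3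
  simp only [mulVec_sub, dotProduct_sub, sub_dotProduct] at h1 h2 h3
  linarith

/-- One step of projected online Newton descent. -/
theorem online_newton_step {K : Set (Fin d → ℝ)} (hK : Convex ℝ K) (hZ : Z.PosDef)
    {a b c v : Fin d → ℝ} (ha : a ∈ K) (hc : c ∈ K)
    (hmin : ∀ a' ∈ K, 1 / 2 * ((a - b) ⬝ᵥ (Z *ᵥ (a - b))) + a ⬝ᵥ v ≤
      1 / 2 * ((a' - b) ⬝ᵥ (Z *ᵥ (a' - b))) + a' ⬝ᵥ v) :
    (a - c) ⬝ᵥ (Z *ᵥ (a - c)) ≤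
      (b - c) ⬝ᵥ (Z *ᵥ (b - c)) - 2 * ((b - c) ⬝ᵥ v) + v ⬝ᵥ (Z⁻¹ *ᵥ v) := by
  have h1 := first_order_optimality hK hZ ha hc hmin
  have h2 := two_mul_dotProduct_le_of_posDef hZ (b - a) v
  have s1 := dotProduct_mulVec_comm_of_posDef hZ a b
  have s2 := dotProduct_mulVec_comm_of_posDef hZ a c
  have s3 := dotProduct_mulVec_comm_of_posDef hZ b c
  simp only [mulVec_sub, dotProduct_sub, sub_dotProduct] at h1 h2 ⊢
  linarith

theorem det_add_smul_vecMulVec_of_posDef (hZ : Z.PosDef) (c : ℝ) (x : Fin d → ℝ) :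
    (Z + c • vecMulVec x x).det = Z.det * (1 + c * (x ⬝ᵥ (Z⁻¹ *ᵥ x))) := by
  have h := det_add_replicateCol_mul_replicateRow (ι := Unit)
    ((isUnit_iff_isUnit_det _).1 hZ.isUnit) (c • x) x
  rw [← vecMulVec_eq Unit, smul_vecMulVec] at h
  rw [h]
  rw [det_unique (n := Unit), Matrix.add_apply, one_apply_eq, Matrix.mul_assoc, ← replicateCol_mulVec,
    replicateRow_mul_replicateCol_apply, mulVec_smul, dotProduct_smul, smul_eq_mul]

theorem posDef_add_smul_vecMulVec (hZ : Z.PosDef) {c : ℝ} (hc : 0 ≤ c) (x : Fin d → ℝ) :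
    (Z + c • vecMulVec x x).PosDef :=
  hZ.add_posSemidef ((by simpa using posSemidef_vecMulVec_self_star x :
    (vecMulVec x x).PosSemidef).smul hc)

theorem mul_inv_norm_le_log_det (hZ : Z.PosDef) {c : ℝ} (hc : 0 ≤ c) (x : Fin d → ℝ) :
    c * (x ⬝ᵥ ((Z + c • vecMulVec x x)⁻¹ *ᵥ x)) ≤
      Real.log (Z + c • vecMulVec x x).det - Real.log Z.det := by
  have hZ' := posDef_add_smul_vecMulVec hZ hc x
  have h := det_add_smul_vecMulVec_of_posDef hZ' (-c) x
  rw [neg_smul, add_neg_cancel_right] at h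
  set W := Z + c • vecMulVec x x
  rw [← Real.log_div hZ'.det_pos.ne' hZ.det_pos.ne']
  have h1 := Real.one_sub_inv_le_log_of_pos (div_pos hZ'.det_pos hZ.det_pos)
  have h2 : (W.det / Z.det)⁻¹ = 1 + -c * (x ⬝ᵥ (W⁻¹ *ᵥ x)) := by
    rw [inv_div, h, mul_div_cancel_left₀ _ hZ'.det_pos.ne']
  linarith

theorem mul_inv_norm_le_two_mul_log_det (hZ : Z.PosDef) {c : ℝ} (hc : 0 ≤ c) (x : Fin d → ℝ)
    (hx : c * (x ⬝ᵥ (Z⁻¹ *ᵥ x)) ≤ 1) :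
    c * (x ⬝ᵥ (Z⁻¹ *ᵥ x)) ≤
      2 * (Real.log (Z + c • vecMulVec x x).det - Real.log Z.det) := by
  have hu : 0 ≤ c * (x ⬝ᵥ (Z⁻¹ *ᵥ x)) :=
    mul_nonneg hc (dotProduct_mulVec_nonneg_of_posDef hZ.inv x)
  rw [det_add_smul_vecMulVec_of_posDef hZ, Real.log_mul hZ.det_pos.ne' (by positivity)]
  have h1 := Real.one_sub_inv_le_log_of_pos (x := 1 + c * (x ⬝ᵥ (Z⁻¹ *ᵥ x))) (by positivity)
  set u := c * (x ⬝ᵥ (Z⁻¹ *ᵥ x))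
  have h2 : u / 2 ≤ 1 - (1 + u)⁻¹ := by
    rw [← sub_nonneg]
    have : 1 - (1 + u)⁻¹ - u / 2 = u * (1 - u) / (2 * (1 + u)) := by field_simp; ring
    rw [this]
    exact div_nonneg (mul_nonneg hu (by linarith)) (by positivity)
  linarith

/-- If `Z` dominates `lam • 1` then `Z⁻¹` is dominated by `lam⁻¹ • 1`. -/
theorem mul_inv_norm_le (hZ : Z.PosDef) {lam : ℝ} (hlam : 0 < lam)
    (hl : ∀ a : Fin d → ℝ, lam * (a ⬝ᵥ a) ≤ a ⬝ᵥ (Z *ᵥ a)) (x : Fin d → ℝ) :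
    lam * (x ⬝ᵥ (Z⁻¹ *ᵥ x)) ≤ x ⬝ᵥ x := by
  set w := Z⁻¹ *ᵥ x with hw
  have h1 := hl w
  rw [hw, mulVec_inv_mulVec_of_posDef hZ, ← hw, dotProduct_comm w x] at h1
  have h2 : 0 ≤ (x - lam • w) ⬝ᵥ (x - lam • w) := by
    simpa using dotProduct_star_self_nonneg (x - lam • w)
  simp only [dotProduct_sub, sub_dotProduct, dotProduct_smul, smul_dotProduct, smul_eq_mul,
    dotProduct_comm w x] at h2
  nlinarith

theorem log_det_le (hZ : Z.PosDef) {c : ℝ} (hc : 0 < c) (htr : Z.trace ≤ d * c) :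
    Real.log Z.det ≤ d * Real.log c := by
  have hp := hZ.eigenvalues_pos
  have hdet := hZ.isHermitian.det_eq_prod_eigenvalues
  have htr' := hZ.isHermitian.trace_eq_sum_eigenvalues
  simp only [RCLike.ofReal_real_eq_id, id] at hdet htr'
  rw [hdet, Real.log_prod (fun i _ => (hp i).ne')]
  have h : ∀ i, Real.log (hZ.isHermitian.eigenvalues i) ≤
      Real.log c + hZ.isHermitian.eigenvalues i / c - 1 := by
    intro i
    have := Real.log_le_sub_one_of_pos (div_pos (hp i) hc)
    rw [Real.log_div (hp i).ne' hc.ne'] at this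
    linarith
  refine (Finset.sum_le_sum fun i _ => h i).trans ?_
  rw [Finset.sum_sub_distrib, Finset.sum_add_distrib, ← Finset.sum_div, ← htr']
  have : Z.trace / c ≤ d := by rwa [div_le_iff₀ hc]
  simp
  linarith
end

theorem exp_mul_le_of_abs_le {σ a s : ℝ} (hσ : 0 < σ) (ha : |a| ≤ σ) :
    Real.exp (a * s - σ ^ 2 / 2 * s ^ 2) ≤
      1 + a * (Real.exp (-(σ ^ 2 / 2 * s ^ 2)) * (Real.sinh (σ * s) / σ)) := by
  obtain ⟨h1, h2⟩ := abs_le.1 ha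
  have hconv : Real.exp (a * s) ≤ Real.cosh (σ * s) + a * (Real.sinh (σ * s) / σ) := by
    have h := convexOn_exp.2 (Set.mem_univ (σ * s)) (Set.mem_univ (-(σ * s)))
      (show 0 ≤ (1 + a / σ) / 2 by
        have : -1 ≤ a / σ := by rw [le_div_iff₀ hσ]; linarith
        linarith)
      (show 0 ≤ (1 - a / σ) / 2 by
        have : a / σ ≤ 1 := by rw [div_le_iff₀ hσ]; linarith
        linarith) (by ring)
    simp only [smul_eq_mul] at h
    have e : (1 + a / σ) / 2 * (σ * s) + (1 - a / σ) / 2 * -(σ * s) = a * s := by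
      field_simp; ring
    rw [e] at h
    refine h.trans_eq ?_
    rw [Real.cosh_eq, Real.sinh_eq]
    field_simp; ring
  have hcosh := Real.cosh_le_exp_half_sq (σ * s)
  have hpos := Real.exp_pos (-(σ ^ 2 / 2 * s ^ 2))
  have e1 : Real.exp ((σ * s) ^ 2 / 2) * Real.exp (-(σ ^ 2 / 2 * s ^ 2)) = 1 := by
    rw [← Real.exp_add, Real.exp_eq_one_iff]; ring
  rw [sub_eq_add_neg, Real.exp_add]
  calc _ ≤ (Real.exp ((σ * s) ^ 2 / 2) + a * (Real.sinh (σ * s) / σ)) *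
        Real.exp (-(σ ^ 2 / 2 * s ^ 2)) :=
        mul_le_mul_of_nonneg_right (by linarith) hpos.le
    _ = _ := by rw [add_mul, e1]; ring

theorem abs_sinh_le (u : ℝ) : |Real.sinh u| ≤ Real.exp |u| := by
  rw [Real.abs_sinh, Real.sinh_eq]
  have := Real.exp_pos (-|u|)
  have := Real.exp_pos (|u|)
  linarith

section
variable {Ω : Type*} {m0 : MeasurableSpace Ω} {P : Measure Ω} [IsProbabilityMeasure P]

theorem integrable_of_measurable_of_abs_le {f : Ω → ℝ} (hf : Measurable f) {C : ℝ}
    (h : ∀ᵐ ω ∂P, |f ω| ≤ C) : Integrable f P :=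
  Integrable.of_bound hf.aestronglyMeasurable C h

theorem integral_mul_exp_le {F : MeasurableSpace Ω} (hF : F ≤ m0) {G a s : Ω → ℝ}
    {σ B C : ℝ} (hσ : 0 < σ) (hG : Measurable[F] G) (hG0 : ∀ ω, 0 ≤ G ω) (hGC : ∀ ω, G ω ≤ C)
    (ha : Measurable[m0] a) (hs : Measurable[F] s) (hsB : ∀ ω, |s ω| ≤ B)
    (hab : ∀ᵐ ω ∂P, |a ω| ≤ σ) (hc : P[a|F] =ᵐ[P] 0) :
    Integrable (fun ω => G ω * Real.exp (a ω * s ω - σ ^ 2 / 2 * s ω ^ 2)) P ∧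
    ∫ ω, G ω * Real.exp (a ω * s ω - σ ^ 2 / 2 * s ω ^ 2) ∂P ≤ ∫ ω, G ω ∂P := by
  set W : Ω → ℝ := fun ω =>
    G ω * (Real.exp (-(σ ^ 2 / 2 * s ω ^ 2)) * (Real.sinh (σ * s ω) / σ)) with hW
  have hG' := hG.mono hF le_rfl
  have hs' := hs.mono hF le_rfl
  have hWm : Measurable[F] W := by
    refine hG.mul (Measurable.mul ?_ ?_)
    · exact Real.measurable_exp.comp (((hs.pow_const 2).const_mul _).neg)
    · exact (Real.measurable_sinh.comp (hs.const_mul σ)).div_const σ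
  have hWb : ∀ ω, |W ω| ≤ C * (1 * (Real.exp (σ * B) / σ)) := by
    intro ω
    rw [hW]
    simp only [abs_mul, abs_div, abs_of_pos hσ, abs_of_nonneg (hG0 ω), Real.abs_exp]
    have h1 : Real.exp (-(σ ^ 2 / 2 * s ω ^ 2)) ≤ 1 :=
      Real.exp_le_one_iff.2 (by have : 0 ≤ σ ^ 2 / 2 * s ω ^ 2 := by positivity
                                linarith)
    have h2 : |Real.sinh (σ * s ω)| ≤ Real.exp (σ * B) := by
      refine (abs_sinh_le _).trans (Real.exp_le_exp.2 ?_)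
      rw [abs_mul, abs_of_pos hσ]
      exact mul_le_mul_of_nonneg_left (hsB ω) hσ.le
    have hC : 0 ≤ C := (hG0 ω).trans (hGC ω)
    gcongr
    exact hGC ω
  have hai : Integrable a P := integrable_of_measurable_of_abs_le ha hab
  have hGi : Integrable G P := integrable_of_measurable_of_abs_le hG' (C := C)
    (.of_forall fun ω => by rw [abs_of_nonneg (hG0 ω)]; exact hGC ω)
  have hWa : Integrable (W * a) P :=
    hai.bdd_mul (hWm.mono hF le_rfl).aestronglyMeasurable (.of_forall hWb)
  have hzero : ∫ ω, (W * a) ω ∂P = 0 := by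
    have h := condExp_mul_of_stronglyMeasurable_left hWm.stronglyMeasurable hWa hai
    rw [← integral_condExp hF, integral_congr_ae h]
    have : W * P[a|F] =ᵐ[P] 0 := by
      filter_upwards [hc] with ω hω
      simp [hω]
    rw [integral_congr_ae this]
    simp
  have hle : ∀ᵐ ω ∂P, G ω * Real.exp (a ω * s ω - σ ^ 2 / 2 * s ω ^ 2) ≤ (G + W * a) ω := by
    filter_upwards [hab] with ω hω
    have h := mul_le_mul_of_nonneg_left (exp_mul_le_of_abs_le (s := s ω) hσ hω) (hG0 ω)
    refine h.trans_eq ?_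
    simp only [Pi.add_apply, Pi.mul_apply, hW]
    ring
  have hsum : Integrable (G + W * a) P := hGi.add hWa
  have hint : Integrable (fun ω => G ω * Real.exp (a ω * s ω - σ ^ 2 / 2 * s ω ^ 2)) P := by
    refine hsum.mono' ?_ ?_
    · exact (hG'.mul (Real.measurable_exp.comp ((ha.mul hs').sub
        ((hs'.pow_const 2).const_mul _)))).aestronglyMeasurable
    · filter_upwards [hle] with ω hω
      rw [Real.norm_eq_abs, abs_of_nonneg (mul_nonneg (hG0 ω) (Real.exp_pos _).le)]
      exact hω
  refine ⟨hint, (integral_mono_ae hint hsum hle).trans_eq ?_⟩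
  rw [integral_add' hGi hWa, hzero, add_zero]

/-- A time-uniform tail bound for sums of bounded martingale differences with predictable
weights. -/
theorem martingale_tail_bound (F : Filtration ℕ m0) {a s : ℕ → Ω → ℝ} {σ B : ℝ}
    (hσ : 0 < σ) (ha : ∀ n, Measurable[F (n + 1)] (a n)) (hs : ∀ n, Measurable[F n] (s n))
    (hsB : ∀ n ω, |s n ω| ≤ B) (hab : ∀ n, ∀ᵐ ω ∂P, |a n ω| ≤ σ)
    (hc : ∀ n, P[a n|F n] =ᵐ[P] 0) (l : ℝ) (N : ℕ) :
    P.real {ω | ∃ n ≤ N, l ≤ ∑ k ∈ Finset.range n,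
      (a k ω * s k ω - σ ^ 2 / 2 * s k ω ^ 2)} ≤ Real.exp (-l) := by
  set S : ℕ → Ω → ℝ := fun n ω => ∑ k ∈ Finset.range n,
    (a k ω * s k ω - σ ^ 2 / 2 * s k ω ^ 2) with hS
  have hSm : ∀ n, Measurable[F n] (S n) := by
    intro n
    refine Finset.measurable_sum _ fun k hk => ?_
    have hk' := Finset.mem_range.1 hk
    have h1 := (ha k).mono (F.mono (Nat.succ_le_of_lt hk')) le_rfl
    have h2 := (hs k).mono (F.mono hk'.le) le_rfl
    exact (h1.mul h2).sub ((h2.pow_const 2).const_mul _)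
  set A : ℕ → Set Ω := fun n => {ω | ∀ k ≤ n, S k ω < l} with hA
  have hAm : ∀ n, MeasurableSet[F n] (A n) := by
    intro n
    have : A n = ⋂ k ∈ Finset.range (n + 1), {ω | S k ω < l} := by
      ext ω; simp [hA]
    rw [this]
    refine Finset.measurableSet_biInter _ fun k hk => ?_
    have hk' : k ≤ n := by simpa [Nat.lt_succ_iff] using hk
    exact F.mono hk' _ (measurableSet_lt (hSm k) measurable_const)
  have hAm' : ∀ n, MeasurableSet (A n) := fun n => F.le n _ (hAm n)
  have key : ∀ n, Real.exp l * P.real (A n)ᶜ + ∫ ω in A n, Real.exp (S n ω) ∂P ≤ 1 := by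
    intro n
    induction n with
    | zero =>
      by_cases hl : 0 < l
      · have : A 0 = Set.univ := by ext ω; simp [hA, hS, hl]
        simp [this, hS]
      · have : A 0 = ∅ := by ext ω; simp [hA, hS, hl]
        simp [this]
        linarith
    | succ n ih =>
      set C : Set Ω := A n ∩ {ω | l ≤ S (n + 1) ω} with hC
      have hCm : MeasurableSet C := (hAm' n).inter
        (measurableSet_le measurable_const ((hSm (n + 1)).mono (F.le _) le_rfl))
      have hsplit : A n = A (n + 1) ∪ C := by
        ext ω
        simp only [hA, hC, Set.mem_ofPred_eq, Set.mem_union, Set.mem_inter_iff]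
        constructor
        · intro h
          rcases lt_or_ge (S (n + 1) ω) l with h' | h'
          · left
            intro k hk
            rcases Nat.le_succ_iff.1 hk with hk | rfl
            · exact h k hk
            · exact h'
          · exact Or.inr ⟨h, h'⟩
        · rintro (h | h)
          · exact fun k hk => h k (hk.trans n.le_succ)
          · exact h.1
      have hdisj : Disjoint (A (n + 1)) C := by
        rw [Set.disjoint_left]
        intro ω h1 h2
        exact absurd (h1 (n + 1) le_rfl) (not_lt.2 h2.2)
      have hstep := integral_mul_exp_le (P := P) (F.le n) (B := B) (C := Real.exp l)
        (G := (A n).indicator fun ω => Real.exp (S n ω)) hσ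
        ((Real.measurable_exp.comp (hSm n)).indicator (hAm n))
        (fun ω => Set.indicator_nonneg (fun _ _ => (Real.exp_pos _).le) ω)
        (fun ω => by
          by_cases h : ω ∈ A n
          · rw [Set.indicator_of_mem h]
            exact Real.exp_le_exp.2 (h n le_rfl).le
          · rw [Set.indicator_of_notMem h]
            exact (Real.exp_pos _).le)
        ((ha n).mono (F.le _) le_rfl) (hs n) (hsB n) (hab n) (hc n)
      have hG : (fun ω => (A n).indicator (fun ω => Real.exp (S n ω)) ω *
          Real.exp (a n ω * s n ω - σ ^ 2 / 2 * s n ω ^ 2)) =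
          (A n).indicator fun ω => Real.exp (S (n + 1) ω) := by
        ext ω
        by_cases h : ω ∈ A n
        · simp only [Set.indicator_of_mem h]
          rw [← Real.exp_add, hS]
          simp only [Finset.sum_range_succ]
        · simp [Set.indicator_of_notMem h]
      rw [hG, integral_indicator (hAm' n), integral_indicator (hAm' n),
        integrable_indicator_iff (hAm' n)] at hstep
      obtain ⟨hint, hle⟩ := hstep
      have hint1 := hint.mono_set (hsplit ▸ Set.subset_union_left : A (n + 1) ⊆ A n)
      have hint2 : IntegrableOn (fun ω => Real.exp (S (n + 1) ω)) C P :=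
        hint.mono_set Set.inter_subset_left
      have hI : ∫ ω in A n, Real.exp (S (n + 1) ω) ∂P =
          ∫ ω in A (n + 1), Real.exp (S (n + 1) ω) ∂P +
            ∫ ω in C, Real.exp (S (n + 1) ω) ∂P := by
        conv_lhs => rw [hsplit]
        exact setIntegral_union hdisj hCm hint1 hint2
      have hCl : Real.exp l * P.real C ≤ ∫ ω in C, Real.exp (S (n + 1) ω) ∂P := by
        have := setIntegral_mono_on (integrable_const (Real.exp l)).integrableOn hint2 hCm
          (fun ω hω => Real.exp_le_exp.2 hω.2)
        rwa [setIntegral_const, smul_eq_mul, mul_comm] at this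
      have hPc : P.real (A (n + 1))ᶜ = P.real (A n)ᶜ + P.real C := by
        rw [probReal_compl_eq_one_sub (hAm' _), probReal_compl_eq_one_sub (hAm' _)]
        have : P.real (A n) = P.real (A (n + 1)) + P.real C := by
          conv_lhs => rw [hsplit]
          exact measureReal_union hdisj hCm
        linarith
      rw [hPc]
      linarith
  have hcompl : {ω | ∃ n ≤ N, l ≤ S n ω} = (A N)ᶜ := by
    ext ω; simp [hA]
  rw [hcompl, Real.exp_neg, ← one_div, le_div_iff₀' (Real.exp_pos l)]
  have h0 : 0 ≤ ∫ ω in A N, Real.exp (S N ω) ∂P :=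
    integral_nonneg fun ω => (Real.exp_pos _).le
  linarith [key N]

end

/-- A function whose graph lies in a closed relation over a compact set, with uniqueness of the
related point, is measurable. -/
theorem measurable_of_unique_mem_closed {Ω E Q : Type*} [MeasurableSpace Ω]
    [TopologicalSpace E] [MeasurableSpace E] [BorelSpace E]
    [TopologicalSpace Q] [MeasurableSpace Q] [BorelSpace Q] {K : Set E} (hK : IsCompact K)
    {G : Set (Q × E)} (hG : IsClosed G) {p : Ω → Q} (hp : Measurable p) {h : Ω → E}
    (hmem : ∀ ω, h ω ∈ K ∧ (p ω, h ω) ∈ G)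
    (huniq : ∀ ω, ∀ a ∈ K, (p ω, a) ∈ G → a = h ω) : Measurable h := by
  refine measurable_of_isClosed fun C hC => ?_
  have : CompactSpace K := isCompact_iff_compactSpace.1 hK
  set H : Set (Q × K) := {q | (q.1, (q.2 : E)) ∈ G ∧ (q.2 : E) ∈ C} with hH
  have hHc : IsClosed H :=
    (hG.preimage (by fun_prop : Continuous fun q : Q × K => (q.1, (q.2 : E)))).inter
      (hC.preimage (by fun_prop : Continuous fun q : Q × K => (q.2 : E)))
  have hpre : h ⁻¹' C = p ⁻¹' (Prod.fst '' H) := by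
    ext ω
    simp only [Set.mem_preimage, Set.mem_image, Prod.exists, exists_and_right, exists_eq_right]
    constructor
    · exact fun hω => ⟨⟨h ω, (hmem ω).1⟩, (hmem ω).2, hω⟩
    · rintro ⟨⟨a, ha⟩, h1, h2⟩
      rw [← huniq ω a ha h1]
      exact h2
  rw [hpre]
  exact hp (isClosedMap_fst_of_compactSpace _ hHc).measurableSet

/-- The Euclidean ball of radius `D` centred at the origin. -/
def l2Ball (d : ℕ) (D : ℝ) : Set (Fin d → ℝ) :=
  {a | Real.sqrt (∑ j, a j ^ 2) ≤ D}

theorem l2Ball_eq_image (d : ℕ) (D : ℝ) :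
    l2Ball d D = EuclideanSpace.equiv (Fin d) ℝ '' Metric.closedBall 0 D := by
  ext a
  constructor
  · exact fun ha => ⟨WithLp.toLp 2 a, by simpa [l2Ball, EuclideanSpace.norm_eq] using ha, rfl⟩
  · rintro ⟨b, hb, rfl⟩
    simpa [l2Ball, EuclideanSpace.norm_eq] using hb

theorem convex_l2Ball (d : ℕ) (D : ℝ) : Convex ℝ (l2Ball d D) := by
  rw [l2Ball_eq_image]
  exact (convex_closedBall _ _).is_linear_image
    (EuclideanSpace.equiv (Fin d) ℝ).toLinearEquiv.toLinearMap.isLinear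

theorem isCompact_l2Ball (d : ℕ) (D : ℝ) : IsCompact (l2Ball d D) := by
  rw [l2Ball_eq_image]
  exact (isCompact_closedBall _ _).image (EuclideanSpace.equiv (Fin d) ℝ).continuous

theorem dotProduct_self_le_of_mem_l2Ball {d : ℕ} {D : ℝ} {a : Fin d → ℝ}
    (ha : a ∈ l2Ball d D) : a ⬝ᵥ a ≤ D ^ 2 := by
  have := (Real.sqrt_le_iff.1 ha).2
  simpa [dotProduct, sq] using this

theorem dotProduct_mem_Icc_of_mem_l2Ball {d : ℕ} {D : ℝ} (hD : 0 < D) {a x : Fin d → ℝ}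
    (ha : a ∈ l2Ball d D) (hx : x ∈ l2Ball d 1) : a ⬝ᵥ x ∈ Set.Icc (-D) D := by
  have h1 := (Real.sqrt_le_iff.1 ha).2
  have h2 := (Real.sqrt_le_iff.1 hx).2
  rw [one_pow] at h2
  have h3 : (a ⬝ᵥ x) ^ 2 ≤ (∑ j, a j ^ 2) * ∑ j, x j ^ 2 :=
    Finset.sum_mul_sq_le_sq_mul_sq Finset.univ a x
  have h4 : (∑ j, a j ^ 2) * ∑ j, x j ^ 2 ≤ ∑ j, a j ^ 2 :=
    mul_le_of_le_one_right (Finset.sum_nonneg fun _ _ => sq_nonneg _) h2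
  exact abs_le.1 (abs_le_of_sq_le_sq (by linarith) hD.le)

theorem paretoGap_le {m : ℕ} {A : Type*} {X : Set A} {μv : A → Fin m → ℝ} {x : A} {w : ℝ}
    (hw : 0 ≤ w) (h : ∀ x' ∈ X, ∃ j, μv x' j ≤ μv x j + w) : paretoGap X μv x ≤ w := by
  refine le_of_forall_pos_le_add fun ε hε => ?_
  refine csInf_le ⟨0, fun _ h => h.1⟩ ⟨by linarith, fun x' hx' => Or.inr ?_⟩
  obtain ⟨j, hj⟩ := h x' hx'
  exact ⟨j, by linarith⟩

theorem strongly_monotone_of_deriv_ge {D κ : ℝ} {f f' : ℝ → ℝ}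
    (hcont : ContinuousOn f (Set.Icc (-D) D))
    (hderiv : ∀ z ∈ Set.Ioo (-D) D, HasDerivAt f (f' z) z)
    (hge : ∀ z ∈ Set.Ioo (-D) D, κ ≤ f' z) :
    ∀ a ∈ Set.Icc (-D) D, ∀ b ∈ Set.Icc (-D) D, κ * (a - b) ^ 2 ≤ (f a - f b) * (a - b) := by
  have key := (convex_Icc (-D) D).mul_sub_le_image_sub_of_le_deriv (C := κ) hcont
    (by rw [interior_Icc]
        exact fun z hz => (hderiv z hz).differentiableAt.differentiableWithinAt)
    (by rw [interior_Icc]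
        exact fun z hz => (hderiv z hz).deriv ▸ hge z hz)
  intro a ha b hb
  rcases le_total a b with h | h
  · nlinarith [key a ha b hb h]
  · nlinarith [key b hb a ha h]

section
variable {d : ℕ}

theorem confidence_step {D κ σ : ℝ} (hD : 0 < D) (hκ : 0 < κ) {f : ℝ → ℝ}
    (hf : ∀ a ∈ Set.Icc (-D) D, ∀ b ∈ Set.Icc (-D) D, κ * (a - b) ^ 2 ≤ (f a - f b) * (a - b))
    {Z : Matrix (Fin d) (Fin d) ℝ} (hZ : Z.PosDef) {a b θ x : Fin d → ℝ} {y : ℝ}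
    (ha : a ∈ l2Ball d D) (hb : b ∈ l2Ball d D) (hθ : θ ∈ l2Ball d D) (hx : x ∈ l2Ball d 1)
    (hy : |f (b ⬝ᵥ x) - y| ≤ σ)
    (hmin : ∀ a' ∈ l2Ball d D,
      1 / 2 * ((a - b) ⬝ᵥ ((Z + (κ / 2) • vecMulVec x x) *ᵥ (a - b))) +
        a ⬝ᵥ ((f (b ⬝ᵥ x) - y) • x) ≤
      1 / 2 * ((a' - b) ⬝ᵥ ((Z + (κ / 2) • vecMulVec x x) *ᵥ (a' - b))) +
        a' ⬝ᵥ ((f (b ⬝ᵥ x) - y) • x)) :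
    (a - θ) ⬝ᵥ ((Z + (κ / 2) • vecMulVec x x) *ᵥ (a - θ)) ≤
      (b - θ) ⬝ᵥ (Z *ᵥ (b - θ)) +
        (2 * ((y - f (θ ⬝ᵥ x)) * ((b - θ) ⬝ᵥ x)) - 3 * κ / 2 * ((b - θ) ⬝ᵥ x) ^ 2) +
        σ ^ 2 * (x ⬝ᵥ ((Z + (κ / 2) • vecMulVec x x)⁻¹ *ᵥ x)) := by
  have hZ' := posDef_add_smul_vecMulVec hZ (half_pos hκ).le x
  have h := online_newton_step (convex_l2Ball d D) hZ' ha hθ hmin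
  set Z' := Z + (κ / 2) • vecMulVec x x with hZdef
  have hb' := dotProduct_mem_Icc_of_mem_l2Ball hD hb hx
  have hθ' := dotProduct_mem_Icc_of_mem_l2Ball hD hθ hx
  have hm := hf _ hb' _ hθ'
  have hq := dotProduct_mulVec_nonneg_of_posDef hZ'.inv x
  have hy2 : (f (b ⬝ᵥ x) - y) ^ 2 ≤ σ ^ 2 := sq_le_sq.2 (hy.trans (le_abs_self σ))
  have hgrad := mul_le_mul_of_nonneg_right hy2 hq
  have hquad : (b - θ) ⬝ᵥ (Z' *ᵥ (b - θ)) =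
      (b - θ) ⬝ᵥ (Z *ᵥ (b - θ)) + κ / 2 * ((b - θ) ⬝ᵥ x) ^ 2 := by
    rw [hZdef, add_mulVec, dotProduct_add, smul_mulVec, vecMulVec_mulVec]
    simp only [dotProduct_smul, smul_eq_mul, MulOpposite.smul_eq_mul_unop,
      MulOpposite.unop_op]
    rw [dotProduct_comm x]
    ring
  rw [hquad] at h
  simp only [mulVec_smul, dotProduct_smul, smul_dotProduct, smul_eq_mul] at h
  have hs : b ⬝ᵥ x - θ ⬝ᵥ x = (b - θ) ⬝ᵥ x := (sub_dotProduct b θ x).symm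
  rw [hs] at hm
  linarith

section design
variable {c lam : ℝ} {x : ℕ → Fin d → ℝ} {Z : ℕ → Matrix (Fin d) (Fin d) ℝ}

theorem design_posDef (hc : 0 ≤ c) (hlam : 0 < lam) (hZ1 : Z 1 = lam • 1)
    (hZ : ∀ t, 1 ≤ t → Z (t + 1) = Z t + c • vecMulVec (x t) (x t)) {t : ℕ} (ht : 1 ≤ t) :
    (Z t).PosDef := by
  induction t, ht using Nat.le_induction with
  | base => rw [hZ1]; exact PosDef.one.smul hlam
  | succ t ht ih => rw [hZ t ht]; exact posDef_add_smul_vecMulVec ih hc _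

theorem design_ge (hc : 0 ≤ c) (hZ1 : Z 1 = lam • 1)
    (hZ : ∀ t, 1 ≤ t → Z (t + 1) = Z t + c • vecMulVec (x t) (x t)) {t : ℕ} (ht : 1 ≤ t)
    (a : Fin d → ℝ) : lam * (a ⬝ᵥ a) ≤ a ⬝ᵥ (Z t *ᵥ a) := by
  induction t, ht using Nat.le_induction with
  | base => simp [hZ1, smul_mulVec]
  | succ t ht ih =>
    rw [hZ t ht, add_mulVec, dotProduct_add, smul_mulVec, vecMulVec_mulVec]
    simp only [dotProduct_smul, smul_eq_mul, MulOpposite.smul_eq_mul_unop, MulOpposite.unop_op]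
    rw [dotProduct_comm (x t) a]
    have := mul_nonneg hc (mul_self_nonneg (a ⬝ᵥ x t))
    linarith

theorem design_trace_le (hc : 0 ≤ c) (hZ1 : Z 1 = lam • 1)
    (hZ : ∀ t, 1 ≤ t → Z (t + 1) = Z t + c • vecMulVec (x t) (x t))
    (hx : ∀ t, 1 ≤ t → x t ⬝ᵥ x t ≤ 1) (n : ℕ) : (Z (n + 1)).trace ≤ d * lam + c * n := by
  induction n with
  | zero => simp [hZ1, mul_comm]
  | succ n ih =>
    rw [hZ (n + 1) (by omega), trace_add, trace_smul, trace_vecMulVec, smul_eq_mul]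
    have := mul_le_of_le_one_right hc (hx (n + 1) (by omega))
    push_cast
    linarith

theorem sum_mul_inv_norm_le (hc : 0 ≤ c) (hlam : 0 < lam) (hZ1 : Z 1 = lam • 1)
    (hZ : ∀ t, 1 ≤ t → Z (t + 1) = Z t + c • vecMulVec (x t) (x t)) (n : ℕ) :
    ∑ k ∈ Finset.range n, c * (x (k + 1) ⬝ᵥ ((Z (k + 2))⁻¹ *ᵥ x (k + 1))) ≤
      Real.log (Z (n + 1)).det - Real.log (Z 1).det := by
  rw [← Finset.sum_range_sub fun k => Real.log (Z (k + 1)).det]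
  refine Finset.sum_le_sum fun k _ => ?_
  have h := hZ (k + 1) (by omega)
  rw [show k + 2 = k + 1 + 1 from rfl, h]
  exact mul_inv_norm_le_log_det (design_posDef hc hlam hZ1 hZ (by omega)) hc _

/-- The elliptical potential lemma. -/
theorem sum_mul_inv_norm_le_two_mul (hc : 0 ≤ c) (hlam : 0 < lam) (hclam : c ≤ lam)
    (hZ1 : Z 1 = lam • 1) (hZ : ∀ t, 1 ≤ t → Z (t + 1) = Z t + c • vecMulVec (x t) (x t))
    (hx : ∀ t, 1 ≤ t → x t ⬝ᵥ x t ≤ 1) (n : ℕ) :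
    ∑ k ∈ Finset.range n, c * (x (k + 1) ⬝ᵥ ((Z (k + 1))⁻¹ *ᵥ x (k + 1))) ≤
      2 * (Real.log (Z (n + 1)).det - Real.log (Z 1).det) := by
  rw [← Finset.sum_range_sub fun k => Real.log (Z (k + 1)).det, Finset.mul_sum]
  refine Finset.sum_le_sum fun k _ => ?_
  have h := hZ (k + 1) (by omega)
  have hpd := design_posDef hc hlam hZ1 hZ (t := k + 1) (by omega)
  rw [h]
  refine mul_inv_norm_le_two_mul_log_det hpd hc _ ?_
  have h1 := mul_inv_norm_le hpd hlam (design_ge hc hZ1 hZ (by omega)) (x (k + 1))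
  have h2 := hx (k + 1) (by omega)
  have h3 := mul_le_mul_of_nonneg_right hclam
    (dotProduct_mulVec_nonneg_of_posDef hpd.inv (x (k + 1)))
  linarith

theorem log_det_design_le (hd : 0 < d) (hc : 0 ≤ c) (hlam : 0 < lam) (hZ1 : Z 1 = lam • 1)
    (hZ : ∀ t, 1 ≤ t → Z (t + 1) = Z t + c • vecMulVec (x t) (x t))
    (hx : ∀ t, 1 ≤ t → x t ⬝ᵥ x t ≤ 1) (n : ℕ) :
    Real.log (Z (n + 1)).det - Real.log (Z 1).det ≤ d * Real.log (1 + c * n / (lam * d)) := by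
  have hd' : (0 : ℝ) < d := by exact_mod_cast hd
  have hpd := design_posDef hc hlam hZ1 hZ (t := n + 1) (by omega)
  have hpos : 0 < 1 + c * n / (lam * d) := by positivity
  have h := log_det_le hpd (c := lam * (1 + c * n / (lam * d))) (by positivity)
    ((design_trace_le hc hZ1 hZ hx n).trans_eq (by field_simp))
  rw [Real.log_mul hlam.ne' hpos.ne'] at h
  have h1 : Real.log (Z 1).det = d * Real.log lam := by
    rw [hZ1, det_smul, det_one, mul_one, Fintype.card_fin, Real.log_pow]
  rw [h1]
  linarith

theorem log_det_design_mono (hc : 0 ≤ c) (hlam : 0 < lam) (hZ1 : Z 1 = lam • 1)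
    (hZ : ∀ t, 1 ≤ t → Z (t + 1) = Z t + c • vecMulVec (x t) (x t)) :
    Monotone fun n => Real.log (Z (n + 1)).det := by
  refine monotone_nat_of_le_succ fun n => ?_
  have hpd := design_posDef hc hlam hZ1 hZ (t := n + 1) (by omega)
  have h := mul_inv_norm_le_log_det hpd hc (x (n + 1))
  rw [← hZ (n + 1) (by omega)] at h
  have := mul_nonneg hc (dotProduct_mulVec_nonneg_of_posDef
    (design_posDef hc hlam hZ1 hZ (t := n + 1 + 1) (by omega)).inv (x (n + 1)))
  linarith

theorem confidence_bound {D κ σ : ℝ} (hD : 0 < D) (hκ : 0 < κ) (hlam : 0 < lam) {f : ℝ → ℝ}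
    (hf : ∀ a ∈ Set.Icc (-D) D, ∀ b ∈ Set.Icc (-D) D, κ * (a - b) ^ 2 ≤ (f a - f b) * (a - b))
    (hZ1 : Z 1 = lam • 1)
    (hZ : ∀ t, 1 ≤ t → Z (t + 1) = Z t + (κ / 2) • vecMulVec (x t) (x t))
    (hx : ∀ t, 1 ≤ t → x t ∈ l2Ball d 1) {θ : Fin d → ℝ} (hθ : θ ∈ l2Ball d D)
    {a : ℕ → Fin d → ℝ} (ha1 : a 1 = 0) (ha : ∀ t, 1 ≤ t → a t ∈ l2Ball d D) {y : ℕ → ℝ}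
    (hy : ∀ t, 1 ≤ t → |f (a t ⬝ᵥ x t) - y t| ≤ σ)
    (hmin : ∀ t, 1 ≤ t → ∀ a' ∈ l2Ball d D,
      1 / 2 * ((a (t + 1) - a t) ⬝ᵥ (Z (t + 1) *ᵥ (a (t + 1) - a t))) +
        a (t + 1) ⬝ᵥ ((f (a t ⬝ᵥ x t) - y t) • x t) ≤
      1 / 2 * ((a' - a t) ⬝ᵥ (Z (t + 1) *ᵥ (a' - a t))) +
        a' ⬝ᵥ ((f (a t ⬝ᵥ x t) - y t) • x t)) (n : ℕ) :
    (a (n + 1) - θ) ⬝ᵥ (Z (n + 1) *ᵥ (a (n + 1) - θ)) ≤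
      lam * D ^ 2 + ∑ k ∈ Finset.range n,
        (2 * ((y (k + 1) - f (θ ⬝ᵥ x (k + 1))) * ((a (k + 1) - θ) ⬝ᵥ x (k + 1))) -
          3 * κ / 2 * ((a (k + 1) - θ) ⬝ᵥ x (k + 1)) ^ 2) +
      2 * σ ^ 2 / κ * (Real.log (Z (n + 1)).det - Real.log (Z 1).det) := by
  have hsum : ∀ n : ℕ, (a (n + 1) - θ) ⬝ᵥ (Z (n + 1) *ᵥ (a (n + 1) - θ)) ≤
      lam * D ^ 2 + ∑ k ∈ Finset.range n,
        (2 * ((y (k + 1) - f (θ ⬝ᵥ x (k + 1))) * ((a (k + 1) - θ) ⬝ᵥ x (k + 1))) -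
          3 * κ / 2 * ((a (k + 1) - θ) ⬝ᵥ x (k + 1)) ^ 2) +
      σ ^ 2 * ∑ k ∈ Finset.range n, x (k + 1) ⬝ᵥ ((Z (k + 2))⁻¹ *ᵥ x (k + 1)) := by
    intro n
    induction n with
    | zero =>
      have := mul_le_mul_of_nonneg_left (dotProduct_self_le_of_mem_l2Ball hθ) hlam.le
      simpa [ha1, hZ1, smul_mulVec, mulVec_neg] using this
    | succ n ih =>
      have h1 : 1 ≤ n + 1 := by omega
      have hm := hmin (n + 1) h1
      have hZn := hZ (n + 1) h1
      rw [hZn] at hm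
      have := confidence_step hD hκ hf (design_posDef (half_pos hκ).le hlam hZ1 hZ h1)
        (ha (n + 1 + 1) (by omega)) (ha (n + 1) h1) hθ (hx (n + 1) h1) (hy (n + 1) h1) hm
      rw [← hZn] at this
      rw [Finset.sum_range_succ, Finset.sum_range_succ]
      linarith
  have h := sum_mul_inv_norm_le (half_pos hκ).le hlam hZ1 hZ n
  rw [← Finset.mul_sum] at h
  have h2 := mul_le_mul_of_nonneg_left h (by positivity : 0 ≤ 2 * σ ^ 2 / κ)
  have e : ∀ q : ℝ, 2 * σ ^ 2 / κ * (κ / 2 * q) = σ ^ 2 * q := by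
    intro q; field_simp
  rw [e] at h2
  linarith [hsum n]

end design

theorem dotProduct_sub_le_of_ucb {Z : Matrix (Fin d) (Fin d) ℝ} (hZ : Z.PosDef)
    {a θ x x' : Fin d → ℝ} {r : ℝ} (hr : (a - θ) ⬝ᵥ (Z *ᵥ (a - θ)) ≤ r)
    (hucb : a ⬝ᵥ x' + Real.sqrt r * Real.sqrt (x' ⬝ᵥ (Z⁻¹ *ᵥ x')) ≤
      a ⬝ᵥ x + Real.sqrt r * Real.sqrt (x ⬝ᵥ (Z⁻¹ *ᵥ x))) :
    θ ⬝ᵥ x' - θ ⬝ᵥ x ≤ 2 * (Real.sqrt r * Real.sqrt (x ⬝ᵥ (Z⁻¹ *ᵥ x))) := by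
  have h0 := (dotProduct_mulVec_nonneg_of_posDef hZ (a - θ)).trans hr
  have key : ∀ u : Fin d → ℝ,
      |(a - θ) ⬝ᵥ u| ≤ Real.sqrt r * Real.sqrt (u ⬝ᵥ (Z⁻¹ *ᵥ u)) := by
    intro u
    rw [← Real.sqrt_mul h0]
    refine Real.abs_le_sqrt ((dotProduct_sq_le_of_posDef hZ _ _).trans ?_)
    exact mul_le_mul_of_nonneg_right hr (dotProduct_mulVec_nonneg_of_posDef hZ.inv u)
  have h1 := (abs_le.1 (key x')).1
  have h2 := (abs_le.1 (key x)).2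
  rw [sub_dotProduct] at h1 h2
  linarith

end

theorem measurable_minimizer {Ω : Type*} [MeasurableSpace Ω] {d : ℕ} {D : ℝ}
    {Z : Ω → Matrix (Fin d) (Fin d) ℝ} {a b v : Ω → Fin d → ℝ}
    (hZm : Measurable fun ω j k => Z ω j k) (hb : Measurable b) (hv : Measurable v)
    (hZ : ∀ ω, (Z ω).PosDef)
    (hmin : ∀ ω, a ω ∈ l2Ball d D ∧ ∀ a' ∈ l2Ball d D,
      1 / 2 * ((a ω - b ω) ⬝ᵥ (Z ω *ᵥ (a ω - b ω))) + a ω ⬝ᵥ v ω ≤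
        1 / 2 * ((a' - b ω) ⬝ᵥ (Z ω *ᵥ (a' - b ω))) + a' ⬝ᵥ v ω) : Measurable a := by
  let G : Set (((Fin d → Fin d → ℝ) × (Fin d → ℝ) × (Fin d → ℝ)) × (Fin d → ℝ)) :=
    {q | ∀ a' ∈ l2Ball d D,
      1 / 2 * ((q.2 - q.1.2.1) ⬝ᵥ (of q.1.1 *ᵥ (q.2 - q.1.2.1))) + q.2 ⬝ᵥ q.1.2.2 ≤
        1 / 2 * ((a' - q.1.2.1) ⬝ᵥ (of q.1.1 *ᵥ (a' - q.1.2.1))) + a' ⬝ᵥ q.1.2.2}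
  have hG : IsClosed G := by
    simp only [G, Set.ofPred_forall]
    refine isClosed_iInter fun a' => isClosed_iInter fun _ => isClosed_le ?_ ?_ <;>
    · simp only [dotProduct, mulVec, of_apply, Pi.sub_apply]
      fun_prop
  exact measurable_of_unique_mem_closed (isCompact_l2Ball d D) hG (hZm.prodMk (hb.prodMk hv))
    (fun ω => hmin ω) fun ω c hc hc' =>
      minimizer_unique (convex_l2Ball d D) (hZ ω) (hmin ω).1 hc (hmin ω).2 hc'

/-- Theorem 2 of the paper.
Under the full MOGLB-UCB setup, with probability at least `1 - δ`, the Pareto regret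
satisfies `PR(T) ≤ 4L·√((dT/κ)·log(1 + κT/(2λd))·γ_{T+1})`. -/
theorem moglb_pareto_regret
    (d m : ℕ) (hd : 1 ≤ d) (hm : 1 ≤ m)
    (D R U κ L lam δ : ℝ) (hD : 0 < D) (hR : 0 < R) (hU : 0 < U) (hκ : 0 < κ)
    (hL : 0 < L) (hlam : max 1 (κ / 2) ≤ lam) (hδ : δ ∈ Set.Ioo (0 : ℝ) 1)
    (X : Finset (Fin d → ℝ)) (hXne : X.Nonempty)
    (hXnorm : ∀ x ∈ X, Real.sqrt (∑ j, x j ^ 2) ≤ 1)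
    (g μ μ' : Fin m → ℝ → ℝ)
    (hg_conv : ∀ i, ConvexOn ℝ Set.univ (g i))
    (hg_deriv : ∀ i, ∀ z : ℝ, HasDerivAt (g i) (μ i z) z)
    (hμ_mono : ∀ i, Monotone (μ i))
    (hμ_lip : ∀ i, ∀ z ∈ Set.Icc (-D) D, ∀ z' ∈ Set.Icc (-D) D,
      |μ i z - μ i z'| ≤ L * |z - z'|)
    (hμ_deriv : ∀ i, ∀ z ∈ Set.Ioo (-D) D, HasDerivAt (μ i) (μ' i z) z)
    (hμ'_ge : ∀ i, ∀ z ∈ Set.Ioo (-D) D, κ ≤ μ' i z)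
    (hμ_bdd : ∀ i, ∀ z ∈ Set.Icc (-D) D, |μ i z| ≤ U)
    (θ : Fin m → Fin d → ℝ) (hθ : ∀ i, Real.sqrt (∑ j, θ i j ^ 2) ≤ D)
    {Ω : Type*} {m0 : MeasurableSpace Ω} (P : Measure Ω) [IsProbabilityMeasure P]
    (F : Filtration ℕ m0)
    (x : ℕ → Ω → Fin d → ℝ)
    (hx_meas : ∀ t, 1 ≤ t → Measurable[F (t - 1)] (x t))
    (hx_mem : ∀ t, 1 ≤ t → ∀ ω, x t ω ∈ X)
    (y : ℕ → Fin m → Ω → ℝ)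
    (hy_meas : ∀ t i, 1 ≤ t → Measurable[F t] (y t i))
    (hy_bdd : ∀ t i, 1 ≤ t → ∀ᵐ ω ∂P, |y t i ω| ≤ R)
    (hy_cond : ∀ t i, 1 ≤ t →
      P[y t i|F (t - 1)] =ᵐ[P] fun ω => μ i (θ i ⬝ᵥ x t ω))
    (Z : ℕ → Ω → Matrix (Fin d) (Fin d) ℝ)
    (hZ1 : ∀ ω, Z 1 ω = lam • (1 : Matrix (Fin d) (Fin d) ℝ))
    (hZrec : ∀ t, 1 ≤ t → ∀ ω,
      Z (t + 1) ω = Z t ω + (κ / 2) • vecMulVec (x t ω) (x t ω))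
    (θhat : ℕ → Fin m → Ω → Fin d → ℝ)
    (hθhat1 : ∀ i ω, θhat 1 i ω = 0)
    (hθhat_rec : ∀ t, 1 ≤ t → ∀ i ω,
      Real.sqrt (∑ j, θhat (t + 1) i ω j ^ 2) ≤ D ∧
      ∀ θ' : Fin d → ℝ, Real.sqrt (∑ j, θ' j ^ 2) ≤ D →
        1 / 2 * ((θhat (t + 1) i ω - θhat t i ω) ⬝ᵥ
            (Z (t + 1) ω *ᵥ (θhat (t + 1) i ω - θhat t i ω))) +
          θhat (t + 1) i ω ⬝ᵥ ((μ i (θhat t i ω ⬝ᵥ x t ω) - y t i ω) • x t ω) ≤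
        1 / 2 * ((θ' - θhat t i ω) ⬝ᵥ (Z (t + 1) ω *ᵥ (θ' - θhat t i ω))) +
          θ' ⬝ᵥ ((μ i (θhat t i ω ⬝ᵥ x t ω) - y t i ω) • x t ω))
    (γ : ℕ → Ω → ℝ)
    (hγ : ∀ t : ℕ, ∀ ω, γ (t + 1) ω =
      16 * (R + U) ^ 2 / κ * Real.log (m / δ * Real.sqrt (1 + 4 * D ^ 2 * t)) +
        lam * D ^ 2 +
        2 * (R + U) ^ 2 / κ * Real.log ((Z (t + 1) ω).det / (Z 1 ω).det) + κ / 2)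
    (hPareto : ∀ t, 1 ≤ t → ∀ ω, ∀ x' ∈ X, ∃ j : Fin m,
      θhat t j ω ⬝ᵥ x' + Real.sqrt (γ t ω) * Real.sqrt (x' ⬝ᵥ ((Z t ω)⁻¹ *ᵥ x')) ≤
        θhat t j ω ⬝ᵥ x t ω +
          Real.sqrt (γ t ω) * Real.sqrt (x t ω ⬝ᵥ ((Z t ω)⁻¹ *ᵥ x t ω)))
    (T : ℕ) (hT : 1 ≤ T) :
    ENNReal.ofReal (1 - δ) ≤
      P {ω | ∑ t ∈ Finset.Icc 1 T,
          paretoGap (X : Set (Fin d → ℝ)) (fun x' i => μ i (θ i ⬝ᵥ x')) (x t ω) ≤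
        4 * L * Real.sqrt (d * T / κ * Real.log (1 + κ * T / (2 * lam * d)) *
          γ (T + 1) ω)} := by
  obtain ⟨hδ0, hδ1⟩ := hδ
  have hlam0 : 0 < lam := one_pos.trans_le ((le_max_left _ _).trans hlam)
  have hκlam : κ / 2 ≤ lam := (le_max_right _ _).trans hlam
  have hκ2 : 0 ≤ κ / 2 := (half_pos hκ).le
  have hm0 : (0 : ℝ) < m := by exact_mod_cast hm
  have hσ : 0 < R + U := by positivity
  have hXball : ∀ t, 1 ≤ t → ∀ ω, x t ω ∈ l2Ball d 1 := fun t ht ω => hXnorm _ (hx_mem t ht ω)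
  have hXone : ∀ t, 1 ≤ t → ∀ ω, x t ω ⬝ᵥ x t ω ≤ 1 := fun t ht ω => by
    simpa using dotProduct_self_le_of_mem_l2Ball (hXball t ht ω)
  have hθball : ∀ i, θ i ∈ l2Ball d D := hθ
  have hθhat_mem : ∀ t, 1 ≤ t → ∀ i ω, θhat t i ω ∈ l2Ball d D := by
    intro t ht i ω
    rcases Nat.lt_or_eq_of_le ht with h | rfl
    · obtain ⟨n, rfl⟩ := Nat.exists_eq_add_of_lt h
      exact (hθhat_rec (1 + n) (by omega) i ω).1
    · simp [hθhat1, l2Ball, hD.le]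
  have hZpd : ∀ t, 1 ≤ t → ∀ ω, (Z t ω).PosDef := fun t ht ω =>
    design_posDef (x := fun t => x t ω) (Z := fun t => Z t ω) hκ2 hlam0 (hZ1 ω)
      (fun t ht => hZrec t ht ω) ht
  have hxm : ∀ n, Measurable[F n] (x (n + 1)) := fun n => hx_meas (n + 1) (by omega)
  have hdot : ∀ {M : MeasurableSpace Ω} {u v : Ω → Fin d → ℝ}, Measurable[M] u →
      Measurable[M] v → Measurable[M] fun ω => u ω ⬝ᵥ v ω := by
    intro M u v hu hv
    exact Finset.measurable_sum _ fun j _ =>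
      ((measurable_pi_apply j).comp hu).mul ((measurable_pi_apply j).comp hv)
  have hZm : ∀ n, ∀ j k, Measurable[F n] fun ω => Z (n + 1) ω j k := by
    intro n j k
    induction n with
    | zero => simp only [zero_add, hZ1]; exact measurable_const
    | succ n ih =>
      have e : (fun ω => Z (n + 1 + 1) ω j k) = fun ω => Z (n + 1) ω j k +
          κ / 2 * (x (n + 1) ω j * x (n + 1) ω k) := by
        ext ω
        rw [hZrec (n + 1) (by omega) ω]
        simp [vecMulVec_apply]
      rw [e]
      have hx' := (hxm n).mono (F.mono n.le_succ) le_rfl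
      exact (ih.mono (F.mono n.le_succ) le_rfl).add
        ((((measurable_pi_apply j).comp hx').mul ((measurable_pi_apply k).comp hx')).const_mul _)
  have hθm : ∀ i n, Measurable[F n] (θhat (n + 1) i) := by
    intro i n
    induction n with
    | zero =>
      have : θhat (0 + 1) i = fun _ => 0 := funext fun ω => hθhat1 i ω
      rw [this]
      exact measurable_const
    | succ n ih =>
      have ih' := ih.mono (F.mono n.le_succ) le_rfl
      have hx' := (hxm n).mono (F.mono n.le_succ) le_rfl
      have hv : Measurable[F (n + 1)] fun ω =>
          (μ i (θhat (n + 1) i ω ⬝ᵥ x (n + 1) ω) - y (n + 1) i ω) • x (n + 1) ω :=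
        (((hμ_mono i).measurable.comp (hdot ih' hx')).sub
          (hy_meas (n + 1) i (by omega))).smul hx'
      have hZf : Measurable[F (n + 1)] fun ω j k => Z (n + 1 + 1) ω j k :=
        @measurable_pi_lambda _ _ _ (F (n + 1)) _ _ fun j =>
          @measurable_pi_lambda _ _ _ (F (n + 1)) _ _ fun k => hZm (n + 1) j k
      exact @measurable_minimizer Ω (F (n + 1)) d D _ _ _ _ hZf ih' hv
        (hZpd (n + 1 + 1) (by omega)) fun ω => hθhat_rec (n + 1) (by omega) i ω
  have hyb : ∀ᵐ ω ∂P, ∀ t i, 1 ≤ t → |y t i ω| ≤ R := by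
    rw [ae_all_iff]; intro t
    rw [ae_all_iff]; intro i
    by_cases ht : 1 ≤ t
    · filter_upwards [hy_bdd t i ht] with ω hω using fun _ => hω
    · exact .of_forall fun ω h => absurd h ht
  set b : ℝ := 3 * κ / (2 * (R + U) ^ 2) with hb
  have hb0 : 0 < b := by positivity
  set a : Fin m → ℕ → Ω → ℝ := fun i n ω =>
    y (n + 1) i ω - μ i (θ i ⬝ᵥ x (n + 1) ω) with ha
  set s : Fin m → ℕ → Ω → ℝ := fun i n ω =>
    (θhat (n + 1) i ω - θ i) ⬝ᵥ x (n + 1) ω with hs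
  set ℓ : ℝ := Real.log (m / δ) with hℓ
  have hℓpos : 0 ≤ ℓ := Real.log_nonneg (by
    rw [le_div_iff₀ hδ0]
    have : (1 : ℝ) ≤ m := by exact_mod_cast hm
    linarith)
  set bad : Fin m → Set Ω := fun i => {ω | ∃ n ≤ T, ℓ ≤ ∑ k ∈ Finset.range n,
    (a i k ω * (b * s i k ω) - (R + U) ^ 2 / 2 * (b * s i k ω) ^ 2)} with hbad
  have hpred : ∀ t, 1 ≤ t → ∀ i ω, θ i ⬝ᵥ x t ω ∈ Set.Icc (-D) D := fun t ht i ω =>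
    dotProduct_mem_Icc_of_mem_l2Ball hD (hθball i) (hXball t ht ω)
  have hpred' : ∀ t, 1 ≤ t → ∀ i ω, θhat t i ω ⬝ᵥ x t ω ∈ Set.Icc (-D) D := fun t ht i ω =>
    dotProduct_mem_Icc_of_mem_l2Ball hD (hθhat_mem t ht i ω) (hXball t ht ω)
  have htail : ∀ i, P.real (bad i) ≤ δ / m := by
    intro i
    have hμm : ∀ n, Measurable[F n] fun ω => μ i (θ i ⬝ᵥ x (n + 1) ω) := fun n =>
      (hμ_mono i).measurable.comp (hdot measurable_const (hxm n))
    have h := martingale_tail_bound (P := P) F (a := a i) (s := fun n ω => b * s i n ω)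
      (B := b * (2 * D)) hσ
      (fun n => (hy_meas (n + 1) i (by omega)).sub ((hμm n).mono (F.mono n.le_succ) le_rfl))
      (fun n => (hdot ((hθm i n).sub_const _) (hxm n)).const_mul b)
      (fun n ω => by
        rw [abs_mul, abs_of_pos hb0]
        refine mul_le_mul_of_nonneg_left ?_ hb0.le
        obtain ⟨h1, h2⟩ := hpred (n + 1) (by omega) i ω
        obtain ⟨h3, h4⟩ := hpred' (n + 1) (by omega) i ω
        simp only [hs, sub_dotProduct]
        exact abs_le.2 ⟨by linarith, by linarith⟩)
      (fun n => by
        filter_upwards [hy_bdd (n + 1) i (by omega)] with ω hω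
        exact (abs_sub _ _).trans (add_le_add hω (hμ_bdd i _ (hpred _ (by omega) i ω))))
      (fun n => by
        have hy_int : Integrable (y (n + 1) i) P := integrable_of_measurable_of_abs_le
          ((hy_meas (n + 1) i (by omega)).mono (F.le _) le_rfl) (hy_bdd (n + 1) i (by omega))
        have hμ_int : Integrable (fun ω => μ i (θ i ⬝ᵥ x (n + 1) ω)) P :=
          integrable_of_measurable_of_abs_le ((hμm n).mono (F.le _) le_rfl)
            (.of_forall fun ω => hμ_bdd i _ (hpred _ (by omega) i ω))
        have h1 := condExp_sub hy_int hμ_int (F n)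
        rw [condExp_of_stronglyMeasurable (F.le n) (hμm n).stronglyMeasurable hμ_int] at h1
        filter_upwards [h1, hy_cond (n + 1) i (by omega)] with ω h2 h3
        have h2' : (P[a i n|F n]) ω = _ := h2
        rw [h2', Pi.sub_apply]
        simp only [Nat.add_sub_cancel] at h3
        rw [h3]
        simp)
      ℓ T
    refine h.trans_eq ?_
    rw [hℓ, Real.exp_neg, Real.exp_log (by positivity), inv_div]
  have hunion : P (⋃ i, bad i) ≤ ENNReal.ofReal δ := by
    refine (measure_iUnion_fintype_le _ _).trans ?_
    calc ∑ i, P (bad i) ≤ ∑ _i : Fin m, ENNReal.ofReal (δ / m) :=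
          Finset.sum_le_sum fun i _ => by
            rw [← ofReal_measureReal]
            exact ENNReal.ofReal_le_ofReal (htail i)
      _ = ENNReal.ofReal δ := by
          rw [Finset.sum_const, Finset.card_univ, Fintype.card_fin, nsmul_eq_mul,
            ← ENNReal.ofReal_natCast, ← ENNReal.ofReal_mul hm0.le]
          congr 1
          field_simp
  have hcompl : ENNReal.ofReal (1 - δ) ≤ P (⋃ i, bad i)ᶜ := by
    rw [ENNReal.ofReal_sub _ hδ0.le, ENNReal.ofReal_one, tsub_le_iff_right]
    calc (1 : ENNReal) = P ((⋃ i, bad i)ᶜ ∪ ⋃ i, bad i) := by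
          rw [Set.compl_union_self, measure_univ]
      _ ≤ P (⋃ i, bad i)ᶜ + P (⋃ i, bad i) := measure_union_le _ _
      _ ≤ _ := by gcongr
  refine hcompl.trans (measure_mono_ae ?_)
  filter_upwards [hyb] with ω hω hgood
  have hgood' : ∀ i, ∀ n ≤ T, ∑ k ∈ Finset.range n,
      (a i k ω * (b * s i k ω) - (R + U) ^ 2 / 2 * (b * s i k ω) ^ 2) < ℓ := by
    intro i n hn
    by_contra! h
    exact hgood (Set.mem_iUnion.2 ⟨i, n, hn, h⟩)
  set ld : ℕ → ℝ := fun n => Real.log (Z (n + 1) ω).det - Real.log (Z 1 ω).det with hld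
  have hld_mono : Monotone ld := fun p q hpq => sub_le_sub_right
    (log_det_design_mono (x := fun t => x t ω) (Z := fun t => Z t ω) hκ2 hlam0 (hZ1 ω)
      (fun t ht => hZrec t ht ω) hpq) _
  have hγ' : ∀ n : ℕ, γ (n + 1) ω =
      16 * (R + U) ^ 2 / κ * (ℓ + Real.log (Real.sqrt (1 + 4 * D ^ 2 * n))) +
        lam * D ^ 2 + 2 * (R + U) ^ 2 / κ * ld n + κ / 2 := by
    intro n
    rw [hγ, Real.log_mul (by positivity) (Real.sqrt_pos.2 (by positivity)).ne',
      Real.log_div (hZpd _ (by omega) ω).det_pos.ne' (hZpd _ le_rfl ω).det_pos.ne']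
  have hlog_nonneg : ∀ n : ℕ, 0 ≤ Real.log (Real.sqrt (1 + 4 * D ^ 2 * n)) := fun n =>
    Real.log_nonneg (Real.one_le_sqrt.2 (le_add_of_nonneg_right (by positivity)))
  have hγ_mono : Monotone fun n => γ (n + 1) ω := by
    intro p q hpq
    simp only [hγ']
    have h1 : (p : ℝ) ≤ q := by exact_mod_cast hpq
    have h2 := hld_mono hpq
    gcongr
  have hconf : ∀ i, ∀ n ≤ T, (θhat (n + 1) i ω - θ i) ⬝ᵥ
      (Z (n + 1) ω *ᵥ (θhat (n + 1) i ω - θ i)) ≤ γ (n + 1) ω := by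
    intro i n hn
    have hcont : ContinuousOn (μ i) (Set.Icc (-D) D) := by
      refine LipschitzOnWith.continuousOn (K := L.toNNReal)
        (LipschitzOnWith.of_dist_le_mul fun z hz z' hz' => ?_)
      rw [Real.dist_eq, Real.dist_eq, Real.coe_toNNReal _ hL.le]
      exact hμ_lip i z hz z' hz'
    have h := confidence_bound (σ := R + U) (x := fun t => x t ω) (Z := fun t => Z t ω)
      (a := fun t => θhat t i ω) (y := fun t => y t i ω) hD hκ hlam0
      (strongly_monotone_of_deriv_ge hcont (hμ_deriv i) (hμ'_ge i)) (hZ1 ω)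
      (fun t ht => hZrec t ht ω) (fun t ht => hXball t ht ω) (hθball i) (hθhat1 i ω)
      (fun t ht => hθhat_mem t ht i ω)
      (fun t ht => by
        have h1 := hμ_bdd i _ (hpred' t ht i ω)
        have h2 := hω t i ht
        exact (abs_sub _ _).trans (by linarith))
      (fun t ht => (hθhat_rec t ht i ω).2) n
    have hg := hgood' i n hn
    have hsum : ∑ k ∈ Finset.range n,
        (2 * (a i k ω * s i k ω) - 3 * κ / 2 * s i k ω ^ 2) =
        2 / b * ∑ k ∈ Finset.range n,
          (a i k ω * (b * s i k ω) - (R + U) ^ 2 / 2 * (b * s i k ω) ^ 2) := by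
      rw [Finset.mul_sum]
      refine Finset.sum_congr rfl fun k _ => ?_
      have : (R + U) ^ 2 * b = 3 * κ / 2 := by rw [hb]; field_simp
      rw [← this]
      field_simp
    have hle : 2 / b * ∑ k ∈ Finset.range n,
        (a i k ω * (b * s i k ω) - (R + U) ^ 2 / 2 * (b * s i k ω) ^ 2) ≤
        16 * (R + U) ^ 2 / κ * (ℓ + Real.log (Real.sqrt (1 + 4 * D ^ 2 * n))) := by
      have h2b : 2 / b ≤ 16 * (R + U) ^ 2 / κ := by
        have e : 2 / b = 4 / 3 * ((R + U) ^ 2 / κ) := by rw [hb]; field_simp; norm_num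
        have : 0 ≤ (R + U) ^ 2 / κ := by positivity
        rw [e, mul_div_assoc]
        linarith
      calc _ ≤ 2 / b * ℓ := mul_le_mul_of_nonneg_left hg.le (by positivity)
        _ ≤ _ := mul_le_mul h2b (le_add_of_nonneg_right (hlog_nonneg n)) hℓpos (by positivity)
    rw [hγ']
    have h' : _ ≤ lam * D ^ 2 + ∑ k ∈ Finset.range n,
        (2 * (a i k ω * s i k ω) - 3 * κ / 2 * s i k ω ^ 2) +
        2 * (R + U) ^ 2 / κ * ld n := h
    rw [hsum] at h'
    linarith
  set q : ℕ → ℝ := fun t => x t ω ⬝ᵥ ((Z t ω)⁻¹ *ᵥ x t ω) with hq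
  have hq0 : ∀ t, 1 ≤ t → 0 ≤ q t := fun t ht =>
    dotProduct_mulVec_nonneg_of_posDef (hZpd t ht ω).inv _
  have hgap : ∀ t ∈ Finset.Icc 1 T,
      paretoGap (X : Set (Fin d → ℝ)) (fun x' i => μ i (θ i ⬝ᵥ x')) (x t ω) ≤
        2 * L * Real.sqrt (γ (T + 1) ω) * Real.sqrt (q t) := by
    intro t ht
    obtain ⟨ht1, htT⟩ := Finset.mem_Icc.1 ht
    obtain ⟨n, rfl⟩ : ∃ n, t = n + 1 := ⟨t - 1, by omega⟩
    refine paretoGap_le (by positivity) fun x' hx' => ?_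
    obtain ⟨j, hj⟩ := hPareto (n + 1) ht1 ω x' hx'
    refine ⟨j, ?_⟩
    have h1 := dotProduct_sub_le_of_ucb (hZpd _ ht1 ω) (hconf j n (by omega)) hj
    have h2 : Real.sqrt (γ (n + 1) ω) * Real.sqrt (q (n + 1)) ≤
        Real.sqrt (γ (T + 1) ω) * Real.sqrt (q (n + 1)) :=
      mul_le_mul_of_nonneg_right (Real.sqrt_le_sqrt (hγ_mono (by omega : n ≤ T)))
        (Real.sqrt_nonneg _)
    have h0 : 0 ≤ 2 * L * Real.sqrt (γ (T + 1) ω) * Real.sqrt (q (n + 1)) := by positivity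
    rcases le_total (θ j ⬝ᵥ x') (θ j ⬝ᵥ x (n + 1) ω) with hle | hle
    · exact (hμ_mono j hle).trans (le_add_of_nonneg_right h0)
    · have h3 := hμ_lip j _ (dotProduct_mem_Icc_of_mem_l2Ball hD (hθball j) (hXnorm x' hx'))
        _ (hpred (n + 1) ht1 j ω)
      rw [abs_of_nonneg (sub_nonneg.2 hle)] at h3
      have h4 := (le_abs_self _).trans h3
      have h5 := mul_le_mul_of_nonneg_left (h1.trans (mul_le_mul_of_nonneg_left h2 two_pos.le))
        hL.le
      linarith
  have hsumq : ∑ t ∈ Finset.Icc 1 T, q t ≤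
      4 * (d / κ * Real.log (1 + κ * T / (2 * lam * d))) := by
    have h1 := sum_mul_inv_norm_le_two_mul (x := fun t => x t ω) (Z := fun t => Z t ω) hκ2 hlam0
      hκlam (hZ1 ω) (fun t ht => hZrec t ht ω) (fun t ht => hXone t ht ω) T
    have h2 := log_det_design_le (x := fun t => x t ω) (Z := fun t => Z t ω) (by omega) hκ2 hlam0
      (hZ1 ω) (fun t ht => hZrec t ht ω) (fun t ht => hXone t ht ω) T
    rw [← Finset.mul_sum] at h1
    have e : ∑ t ∈ Finset.Icc 1 T, q t = ∑ k ∈ Finset.range T, q (k + 1) := by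
      rw [Finset.range_eq_Ico, Finset.sum_Ico_add' q 0 T 1]
      rfl
    have e2 : κ / 2 * T / (lam * d) = κ * T / (2 * lam * d) := by field_simp
    rw [e2] at h2
    have h3 : κ / 2 * ∑ k ∈ Finset.range T, q (k + 1) ≤
        2 * (d * Real.log (1 + κ * T / (2 * lam * d))) := h1.trans (by linarith)
    have e3 : 4 * (d / κ * Real.log (1 + κ * T / (2 * lam * d))) =
        2 / κ * (2 * (d * Real.log (1 + κ * T / (2 * lam * d)))) := by field_simp; norm_num
    rw [e, e3]
    calc _ = 2 / κ * (κ / 2 * ∑ k ∈ Finset.range T, q (k + 1)) := by field_simp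
      _ ≤ _ := mul_le_mul_of_nonneg_left h3 (by positivity)
  have hcs : ∑ t ∈ Finset.Icc 1 T, Real.sqrt (q t) ≤
      Real.sqrt (T * (4 * (d / κ * Real.log (1 + κ * T / (2 * lam * d))))) := by
    refine Real.le_sqrt_of_sq_le ((sq_sum_le_card_mul_sum_sq).trans ?_)
    rw [Nat.card_Icc, Nat.add_sub_cancel]
    refine mul_le_mul_of_nonneg_left ?_ (Nat.cast_nonneg T)
    refine (Finset.sum_congr rfl fun t ht => ?_).trans_le hsumq
    exact Real.sq_sqrt (hq0 t (Finset.mem_Icc.1 ht).1)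
  have hlog0 : 0 ≤ Real.log (1 + κ * T / (2 * lam * d)) :=
    Real.log_nonneg (le_add_of_nonneg_right (by positivity))
  show _ ≤ _
  calc _ ≤ ∑ t ∈ Finset.Icc 1 T, 2 * L * Real.sqrt (γ (T + 1) ω) * Real.sqrt (q t) :=
        Finset.sum_le_sum hgap
    _ ≤ 2 * L * Real.sqrt (γ (T + 1) ω) *
        Real.sqrt (T * (4 * (d / κ * Real.log (1 + κ * T / (2 * lam * d))))) := by
        rw [← Finset.mul_sum]
        exact mul_le_mul_of_nonneg_left hcs (by positivity)
    _ = _ := by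
        have e : T * (4 * (d / κ * Real.log (1 + κ * T / (2 * lam * d)))) =
            2 ^ 2 * (d * T / κ * Real.log (1 + κ * T / (2 * lam * d))) := by ring
        rw [e, Real.sqrt_mul (by positivity), Real.sqrt_sq two_pos.le,
          Real.sqrt_mul (x := d * T / κ * _) (by positivity)]
        ring
end
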